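/- arXiv:math/0105180 — 5 statements merged into one kernel-verified Lean document; each statement's English description precedes it below -/
import Mathlib

section
/- Let n ≥ 3, let c_1, …, c_{2n−2} ∈ ℝ^n be points that affinely span ℝ^n, and let r_1, …, r_{2n−2} > 0. Let T be the set of all one-dimensional affine subspaces L of ℂ^n that are tangent to each of the 2n−2 spheres with center c_i (regarded in ℂ^n) and radius r_i, i.e. such that for some point p ∈ L and nonzero direction vector v of L one has (v·(p−c_i))² = (v·v)·((p−c_i)² − r_i²) for all i. If T is finite, then T has at most 3·2^{n−1} elements. -/
open scoped BigOperators

/-- The bilinear (conjugation-free) dot product on `ℂⁿ`. -/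
noncomputable def dotc {n : ℕ} (x y : Fin n → ℂ) : ℂ := ∑ i, x i * y i

/-- A one-dimensional affine subspace `L ⊆ ℂⁿ` is tangent to the sphere with center `c`
and radius `r` when for some point `p ∈ L` and nonzero direction vector `v` of `L` one has
`(v·(p−c))² = (v·v)·((p−c)² − r²)`. -/
def IsTangentLine {n : ℕ} (L : AffineSubspace ℂ (Fin n → ℂ)) (c : Fin n → ℂ) (r : ℝ) : Prop :=
  ∃ p ∈ L, ∃ v ∈ L.direction, v ≠ 0 ∧
    dotc v (p - c) ^ 2 = dotc v v * (dotc (p - c) (p - c) - (r : ℂ) ^ 2)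

/-- Exponent vectors `e` with `∑ i, d i * e i ≤ M`. -/
def weightedSimplex {σ : Type*} [Fintype σ] [DecidableEq σ] (d : σ → ℕ) (M : ℕ) :
    Finset (σ → ℕ) :=
  (Fintype.piFinset fun _ => Finset.range (M + 1)).filter fun e => ∑ i, d i * e i ≤ M

section Counting

variable {σ : Type*} [Fintype σ] [DecidableEq σ]

lemma mem_weightedSimplex {d : σ → ℕ} (hd : ∀ i, 0 < d i) {M : ℕ} {e : σ → ℕ} :
    e ∈ weightedSimplex d M ↔ ∑ i, d i * e i ≤ M := by
  simp only [weightedSimplex, Finset.mem_filter, Fintype.mem_piFinset, Finset.mem_range,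
    and_iff_right_iff_imp]
  intro h i
  have h1 : d i * e i ≤ ∑ i, d i * e i :=
    Finset.single_le_sum (f := fun i => d i * e i) (fun _ _ => Nat.zero_le _) (Finset.mem_univ i)
  have h2 : e i ≤ d i * e i := Nat.le_mul_of_pos_left _ (hd i)
  omega

lemma card_simplex_le (d : σ → ℕ) (hd : ∀ i, 0 < d i) (M : ℕ) :
    (weightedSimplex (fun _ : σ => 1) M).card ≤ (weightedSimplex d M).card * ∏ i, d i := by
  have key : (weightedSimplex d M ×ˢ Fintype.piFinset fun i => Finset.range (d i)).card =
      (weightedSimplex d M).card * ∏ i, d i := by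
    simp [Finset.card_product]
  rw [← key]
  refine Finset.card_le_card_of_injOn (fun e => (fun i => e i / d i, fun i => e i % d i)) ?_ ?_
  · intro e he
    rw [Finset.mem_coe, mem_weightedSimplex (fun _ => one_pos)] at he
    simp only [Finset.coe_product, Set.mem_prod, Finset.mem_coe, mem_weightedSimplex hd,
      Fintype.mem_piFinset, Finset.mem_range]
    refine ⟨le_trans (Finset.sum_le_sum fun i _ => ?_) he, fun i => Nat.mod_lt _ (hd i)⟩
    simpa using Nat.mul_div_le (e i) (d i)
  · intro e _ e' _ h
    simp only [Prod.mk.injEq, funext_iff] at h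
    funext i
    rw [← Nat.div_add_mod (e i) (d i), h.1 i, h.2 i, Nat.div_add_mod]

/-- Polynomial growth of the simplex beats no geometric progression. -/
lemma exists_card_simplex_add_lt (D : ℕ) :
    ∃ M, D * (weightedSimplex (fun _ : σ => 1) (M + D)).card <
      (D + 1) * (weightedSimplex (fun _ : σ => 1) M).card := by
  set P : ℕ → ℕ := fun M => (weightedSimplex (fun _ : σ => 1) M).card with hP
  by_contra! hcon
  have h0 : 1 ≤ P 0 := Finset.card_pos.2 ⟨0, by simp [mem_weightedSimplex]⟩
  have hgrow : ∀ k, (D + 1) ^ k ≤ D ^ k * P (k * D) := by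
    intro k
    induction k with
    | zero => simpa using h0
    | succ k ih =>
      calc (D + 1) ^ (k + 1) = (D + 1) * (D + 1) ^ k := by ring
        _ ≤ (D + 1) * (D ^ k * P (k * D)) := Nat.mul_le_mul_left _ ih
        _ = D ^ k * ((D + 1) * P (k * D)) := by ring
        _ ≤ D ^ k * (D * P (k * D + D)) := Nat.mul_le_mul_left _ (hcon _)
        _ = D ^ (k + 1) * P ((k + 1) * D) := by rw [add_one_mul k D]; ring
  have hbox : ∀ M, P M ≤ (M + 1) ^ Fintype.card σ := fun M =>
    (Finset.card_filter_le _ _).trans (by simp [Fintype.card_piFinset])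
  set N := Fintype.card σ
  set q : ℝ := D / (D + 1) with hq
  have hq0 : 0 ≤ q := by positivity
  have hq1 : q < 1 := by rw [hq, div_lt_one (by positivity)]; linarith
  have hlim := (tendsto_pow_const_mul_const_pow_of_lt_one N hq0 hq1).const_mul
    (((D : ℝ) + 1) ^ N)
  rw [mul_zero] at hlim
  obtain ⟨k, hk, hk1⟩ :=
    ((hlim.eventually_lt_const one_pos).and (Filter.eventually_ge_atTop 1)).exists
  have h1 : ((D : ℝ) + 1) ^ k ≤ D ^ k * ((D + 1) * k) ^ N := by
    have : (D + 1) ^ k ≤ D ^ k * ((D + 1) * k) ^ N :=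
      (hgrow k).trans (Nat.mul_le_mul_left _ ((hbox _).trans
        (Nat.pow_le_pow_left (by nlinarith) _)))
    exact_mod_cast this
  have h2 : ((D : ℝ) + 1) ^ N * (k ^ N * q ^ k) =
      D ^ k * ((D + 1) * k) ^ N / (D + 1) ^ k := by
    rw [hq, div_pow, mul_pow]; ring
  rw [h2, div_lt_one (by positivity)] at hk
  linarith

end Counting

section Bezout

open MvPolynomial

variable {σ K : Type*} [Field K]

lemma finrank_restrictTotalDegree_le [Fintype σ] [DecidableEq σ] (M : ℕ) :
    Module.finrank K (restrictTotalDegree σ K M) ≤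
      (weightedSimplex (fun _ : σ => 1) M).card := by
  rw [restrictTotalDegree, Module.finrank_eq_nat_card_basis (basisRestrictSupport K _),
    ← Nat.card_eq_finsetCard]
  refine Nat.card_le_card_of_injective (fun e => ⟨⇑e.1, ?_⟩) fun e e' h => ?_
  · have := e.2
    rw [Set.mem_ofPred_eq, Finsupp.sum_fintype _ _ (fun _ => rfl)] at this
    simpa [mem_weightedSimplex] using this
  · exact Subtype.ext (DFunLike.coe_injective (congrArg Subtype.val h))

/-- A version of Perron's theorem: a polynomial `h` of degree one satisfies a polynomial relation
of degree at most `∏ i, d i` over the subring generated by polynomials `f i` of degrees `d i`. -/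
lemma exists_relation [Fintype σ] (f : σ → MvPolynomial σ K) (d : σ → ℕ) (hd : ∀ i, 0 < d i)
    (hf : ∀ i, (f i).totalDegree ≤ d i) (h : MvPolynomial σ K) (hh : h.totalDegree ≤ 1) :
    ∃ Q : Fin (∏ i, d i + 1) → MvPolynomial σ K, Q ≠ 0 ∧
      ∑ j, aeval f (Q j) * h ^ (j : ℕ) = 0 := by
  classical
  set D := ∏ i, d i with hD
  obtain ⟨M, hM⟩ := exists_card_simplex_add_lt (σ := σ) D
  let A := weightedSimplex d M
  have hdeg : ∀ x : A × Fin (D + 1), (∏ i, f i ^ x.1.1 i) * h ^ (x.2 : ℕ) ∈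
      restrictTotalDegree σ K (M + D) := by
    rintro ⟨⟨a, ha⟩, j⟩
    rw [mem_restrictTotalDegree]
    refine (totalDegree_mul _ _).trans (add_le_add ?_ ?_)
    · refine (totalDegree_finsetProd _ _).trans (le_trans (Finset.sum_le_sum fun i _ => ?_)
        ((mem_weightedSimplex hd).1 ha))
      refine (totalDegree_pow _ _).trans ?_
      rw [mul_comm]
      exact Nat.mul_le_mul_right _ (hf i)
    · refine (totalDegree_pow _ _).trans ((Nat.mul_le_mul_left _ hh).trans ?_)
      have := j.2
      simp only [mul_one]; omega
  let v : A × Fin (D + 1) → restrictTotalDegree σ K (M + D) := fun x => ⟨_, hdeg x⟩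
  have hv : ¬ LinearIndependent K v := by
    intro hli
    have h1 := hli.fintype_card_le_finrank.trans (finrank_restrictTotalDegree_le (M + D))
    rw [Fintype.card_prod, Fintype.card_coe, Fintype.card_fin] at h1
    have h2 : _ ≤ A.card * D := card_simplex_le d hd M
    have h3 := Nat.mul_le_mul_left D h1
    have h4 := Nat.mul_le_mul_left (D + 1) h2
    have h5 : D * (A.card * (D + 1)) = (D + 1) * (A.card * D) := by ring
    linarith
  obtain ⟨g, hg, ⟨a₀, j₀⟩, hne⟩ := Fintype.not_linearIndependent_iff.1 hv
  refine ⟨fun j => ∑ a : A, monomial (Finsupp.equivFunOnFinite.symm a.1) (g (a, j)), ?_, ?_⟩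
  · intro h0
    have h1 := congrArg (coeff (Finsupp.equivFunOnFinite.symm a₀.1)) (congrFun h0 j₀)
    simp only [coeff_sum, coeff_monomial, EmbeddingLike.apply_eq_iff_eq, Pi.zero_apply,
      coeff_zero, Subtype.coe_inj, Finset.sum_ite_eq', Finset.mem_univ, if_true] at h1
    exact hne h1
  · have h1 := congrArg Subtype.val hg
    simp only [AddSubmonoidClass.coe_finsetSum, Submodule.coe_smul, ZeroMemClass.coe_zero, v,
      Fintype.sum_prod_type_right] at h1
    rw [← h1]
    refine Finset.sum_congr rfl fun j _ => ?_
    rw [map_sum, Finset.sum_mul]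
    refine Finset.sum_congr rfl fun a _ => ?_
    rw [aeval_monomial, Finsupp.prod_fintype _ _ (by simp), smul_eq_C_mul, mul_assoc]
    rfl

lemma exists_eval_ne_zero [Infinite K] {p : MvPolynomial σ K} (hp : p ≠ 0) :
    ∃ x, eval x p ≠ 0 := by
  by_contra! h
  exact hp (MvPolynomial.funext fun x => by rw [h x, map_zero])

/-- A generic linear form separates the points of a finite set. -/
lemma exists_linear_injOn [Fintype σ] [Infinite K] (Z : Finset (σ → K)) :
    ∃ h : MvPolynomial σ K, h.totalDegree ≤ 1 ∧ Set.InjOn (fun x => eval x h) Z := by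
  classical
  let p : MvPolynomial σ K := ∏ z ∈ Z.offDiag, ∑ i, C (z.1 i - z.2 i) * X i
  have hp : p ≠ 0 := by
    refine Finset.prod_ne_zero_iff.2 fun z hz h0 => (Finset.mem_offDiag.1 hz).2.2 ?_
    funext i
    have := congrArg (eval (Pi.single i 1)) h0
    simpa [Pi.single_apply, sub_eq_zero] using this
  obtain ⟨w, hw⟩ := exists_eval_ne_zero hp
  refine ⟨∑ i, C (w i) * X i, ?_, fun x hx y hy hxy => ?_⟩
  · refine totalDegree_finsetSum_le fun i _ => (totalDegree_mul _ _).trans ?_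
    rw [totalDegree_C, totalDegree_X]
  · by_contra hne
    rw [map_prod, Finset.prod_ne_zero_iff] at hw
    refine hw (x, y) (Finset.mem_offDiag.2 ⟨hx, hy, hne⟩) ?_
    simp only [map_sum, map_mul, eval_C, eval_X] at hxy ⊢
    rw [← sub_eq_zero, ← Finset.sum_sub_distrib] at hxy
    rw [← hxy]
    exact Finset.sum_congr rfl fun i _ => by ring

/-- Translation of the variables by `b`. -/
noncomputable def translateEquiv (b : σ → K) : MvPolynomial σ K ≃ₐ[K] MvPolynomial σ K :=
  AlgEquiv.ofAlgHom (aeval fun i => X i + C (b i)) (aeval fun i => X i - C (b i))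
    (by ext i; simp [← algebraMap_eq]) (by ext i; simp [← algebraMap_eq])

lemma comap_translateEquiv (a b : σ → K) :
    (vanishingIdeal K {a}).comap (translateEquiv b : MvPolynomial σ K →+* MvPolynomial σ K) =
      vanishingIdeal K {a + b} := by
  ext p
  rw [Ideal.mem_comap, mem_vanishingIdeal_singleton_iff, mem_vanishingIdeal_singleton_iff]
  have : (aeval a).comp (translateEquiv b : MvPolynomial σ K →ₐ[K] MvPolynomial σ K) =
      aeval (a + b) := by
    ext i; simp [translateEquiv]
  exact Eq.congr_left (DFunLike.congr_fun this p)

lemma height_vanishingIdeal_singleton [Fintype σ] [IsAlgClosed K] (a : σ → K) :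
    (vanishingIdeal K {a} : Ideal (MvPolynomial σ K)).height = Fintype.card σ := by
  have hdim : ringKrullDim (MvPolynomial σ K) = Fintype.card σ := by
    rw [ringKrullDim_of_isNoetherianRing]; simp
  have : FiniteRingKrullDim (MvPolynomial σ K) := by
    rw [finiteRingKrullDim_iff_ne_bot_and_top, hdim]
    exact ⟨by simp, WithBot.coe_injective.ne (ENat.natCast_ne_top (Fintype.card σ))⟩
  obtain ⟨m, hm, hmh⟩ := Ideal.exists_isMaximal_height (R := MvPolynomial σ K)
  obtain ⟨b, rfl⟩ := isMaximal_iff_eq_vanishingIdeal_singleton.1 hm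
  have h := (translateEquiv (b - a)).toRingEquiv.height_comap (vanishingIdeal K {a})
  have h' := comap_translateEquiv a (b - a)
  rw [add_sub_cancel] at h'
  rw [hdim] at hmh
  have h2 : (vanishingIdeal K {b} : Ideal (MvPolynomial σ K)).height =
    (vanishingIdeal K {a} : Ideal (MvPolynomial σ K)).height := by
    rw [← h, ← h']; rfl
  rw [← h2]
  exact_mod_cast hmh

/-- A prime ideal with finite zero locus is the ideal of each of its zeros. -/
lemma eq_vanishingIdeal_of_finite_zeroLocus [Finite σ] [IsAlgClosed K] (P : Ideal (MvPolynomial σ K))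
    [P.IsPrime] (hfin : (zeroLocus K P).Finite) {a : σ → K} (ha : P ≤ vanishingIdeal K {a}) :
    P = vanishingIdeal K {a} := by
  have hP : hfin.toFinset.inf (fun q => (vanishingIdeal K {q} : Ideal (MvPolynomial σ K))) ≤ P := by
    intro p hp
    rw [Submodule.mem_finsetInf] at hp
    rw [← IsPrime.vanishingIdeal_zeroLocus (K := K) P]
    intro x hx
    exact hp x (hfin.mem_toFinset.2 hx) x rfl
  obtain ⟨q, -, hq⟩ := (Ideal.IsPrime.inf_le' inferInstance).1 hP
  have hmax : (vanishingIdeal K {q} : Ideal (MvPolynomial σ K)).IsMaximal := inferInstance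
  have hqP := hmax.eq_of_le (Ideal.IsPrime.ne_top inferInstance) hq
  rw [hqP] at hmax
  exact hmax.eq_of_le (Ideal.IsPrime.ne_top inferInstance) ha

/-- Through an isolated common zero `a` of the `f i` there passes an irreducible curve on which
`f` is proportional to a given vector `u` and not identically zero. -/
lemma exists_prime_proportional [Fintype σ] [IsAlgClosed K] (f : σ → MvPolynomial σ K)
    (hfin : {x | ∀ i, eval x (f i) = 0}.Finite) {a : σ → K} (ha : ∀ i, eval a (f i) = 0)
    (u : σ → K) {i₀ : σ} (hu : u i₀ ≠ 0) :
    ∃ P : Ideal (MvPolynomial σ K), P.IsPrime ∧ P ≤ vanishingIdeal K {a} ∧ f i₀ ∉ P ∧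
      ∀ j, C (u i₀) * f j - C (u j) * f i₀ ∈ P := by
  classical
  let g : σ → MvPolynomial σ K := fun j => C (u i₀) * f j - C (u j) * f i₀
  let s : Finset (MvPolynomial σ K) := (Finset.univ.erase i₀).image g
  have hIa : Ideal.span (s : Set (MvPolynomial σ K)) ≤ vanishingIdeal K {a} := by
    rw [Ideal.span_le]
    intro p hp
    simp only [s, Finset.coe_image, Set.mem_image] at hp
    obtain ⟨j, -, rfl⟩ := hp
    rw [SetLike.mem_coe, mem_vanishingIdeal_singleton_iff]
    simp [g, aeval_eq_eval, ha]
  obtain ⟨P, hPmin, hPa⟩ := Ideal.exists_minimalPrimes_le hIa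
  have hprime : P.IsPrime := hPmin.1.1
  have hmem : ∀ j, g j ∈ P := by
    intro j
    by_cases hj : j = i₀
    · subst hj; simp [g]
    · refine hPmin.1.2 (Ideal.subset_span ?_)
      simp only [s, Finset.coe_image]
      exact ⟨j, by simp [hj], rfl⟩
  refine ⟨P, hprime, hPa, fun hf => ?_, hmem⟩
  have hfP : ∀ j, f j ∈ P := by
    intro j
    have h1 : C (u i₀) * f j ∈ P := by
      have := P.add_mem (hmem j) (P.mul_mem_left (C (u j)) hf)
      simpa [g] using this
    have h2 := P.mul_mem_left (C (u i₀)⁻¹) h1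
    rwa [← mul_assoc, ← C_mul, inv_mul_cancel₀ hu, C_1, one_mul] at h2
  have hPfin : (zeroLocus K P).Finite := hfin.subset fun x hx i => hx _ (hfP i)
  have hPeq := eq_vanishingIdeal_of_finite_zeroLocus P hPfin hPa
  have hle := Ideal.height_le_card_of_mem_minimalPrimes_span_finset hPmin
  rw [hPeq, height_vanishingIdeal_singleton, Nat.cast_le] at hle
  have hcard : s.card ≤ (Finset.univ.erase i₀).card := Finset.card_image_le
  have hlt : (Finset.univ.erase i₀).card < Fintype.card σ :=
    Finset.card_lt_card (Finset.erase_ssubset (Finset.mem_univ i₀))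
  omega

/-- **Bézout's inequality**: as many polynomials as variables with finitely many common zeros have
at most as many common zeros as the product of their degrees. -/
theorem ncard_zeros_le_prod_degree [Fintype σ] [IsAlgClosed K] (f : σ → MvPolynomial σ K) (d : σ → ℕ)
    (hd : ∀ i, 0 < d i) (hf : ∀ i, (f i).totalDegree ≤ d i)
    (hfin : {x | ∀ i, eval x (f i) = 0}.Finite) :
    {x | ∀ i, eval x (f i) = 0}.ncard ≤ ∏ i, d i := by
  have : Infinite K := IsAlgClosed.instInfinite
  rcases isEmpty_or_nonempty σ with hσ | ⟨⟨i₀⟩⟩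
  · simp
  obtain ⟨h, hh, hinj⟩ := exists_linear_injOn hfin.toFinset
  rw [hfin.coe_toFinset] at hinj
  obtain ⟨Q, hQ, hrel⟩ := exists_relation f d hd hf h hh
  obtain ⟨j₀, hj₀⟩ := Function.ne_iff.1 hQ
  obtain ⟨u, hu⟩ := exists_eval_ne_zero (mul_ne_zero hj₀ (X_ne_zero i₀))
  rw [map_mul, eval_X] at hu
  have hui := right_ne_zero_of_mul hu
  let R : Fin (∏ i, d i + 1) → Polynomial K :=
    fun j => aeval (fun i => Polynomial.C (u i) * Polynomial.X) (Q j)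
  have hR : ∃ m, ∃ j, (R j).coeff m ≠ 0 := by
    by_contra! hcon
    have h0 : R j₀ = 0 := Polynomial.ext fun m => by simpa using hcon m j₀
    have h1 : (Polynomial.aeval (1 : K)) (R j₀) = eval u (Q j₀) := by
      rw [← aeval_eq_eval, ← AlgHom.comp_apply]
      congr 1
      ext i; simp
    rw [h0, map_zero] at h1
    exact left_ne_zero_of_mul hu h1.symm
  classical
  let m := Nat.find hR
  obtain ⟨j₁, hj₁⟩ : ∃ j, (R j).coeff m ≠ 0 := Nat.find_spec hR
  have hdvd : ∀ j, Polynomial.X ^ m ∣ R j := fun j =>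
    Polynomial.X_pow_dvd_iff.2 fun k hk => by
      by_contra hne
      exact Nat.find_min hR hk ⟨j, hne⟩
  choose R' hR' using hdvd
  let W : Polynomial K := ∑ j, Polynomial.C ((R j).coeff m) * Polynomial.X ^ (j : ℕ)
  have hW : W ≠ 0 := by
    intro h0
    have := congrArg (fun p => Polynomial.coeff p (j₁ : ℕ)) h0
    simp [W, Polynomial.coeff_X_pow, Fin.val_inj] at this
    exact hj₁ this
  have hWdeg : W.natDegree ≤ ∏ i, d i :=
    Polynomial.natDegree_sum_le_of_forall_le _ _ fun j _ =>
      (Polynomial.natDegree_C_mul_X_pow_le _ _).trans (Nat.lt_succ_iff.1 j.2)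
  have hroot : ∀ a ∈ {x | ∀ i, eval x (f i) = 0}, eval a h ∈ W.roots.toFinset := by
    intro a ha
    obtain ⟨P, hprime, hPa, hfP, hprop⟩ := exists_prime_proportional f hfin ha u hui
    let t : MvPolynomial σ K := C (u i₀)⁻¹ * f i₀
    have htP : t ∉ P := fun ht => hfP <| by
      have := P.mul_mem_left (C (u i₀)) ht
      rwa [← mul_assoc, ← C_mul, mul_inv_cancel₀ hui, C_1, one_mul] at this
    have hft : ∀ i, f i - C (u i) * t ∈ P := by
      intro i
      have := P.mul_mem_left (C (u i₀)⁻¹) (hprop i)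
      rw [mul_sub, ← mul_assoc, ← C_mul, inv_mul_cancel₀ hui, C_1, one_mul] at this
      convert this using 2
      simp only [t]; ring
    have hQt : ∀ j, aeval f (Q j) - t ^ m * Polynomial.aeval t (R' j) ∈ P := by
      intro j
      have h1 : t ^ m * Polynomial.aeval t (R' j) = aeval (fun i => C (u i) * t) (Q j) := by
        have h2 : Polynomial.aeval t (R j) = aeval (fun i => C (u i) * t) (Q j) := by
          rw [← AlgHom.comp_apply]
          congr 1
          ext1 i; simp [algebraMap_eq]
        rw [← h2, hR' j]; simp
      rw [h1, ← Ideal.Quotient.mk_eq_mk_iff_sub_mem]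
      change (Ideal.Quotient.mkₐ K P) _ = (Ideal.Quotient.mkₐ K P) _
      rw [← AlgHom.comp_apply, ← AlgHom.comp_apply]
      congr 1
      ext1 i
      simpa using (Ideal.Quotient.mk_eq_mk_iff_sub_mem _ _).2 (hft i)
    have hsum : t ^ m * ∑ j, Polynomial.aeval t (R' j) * h ^ (j : ℕ) ∈ P := by
      have h1 := P.sum_mem (t := Finset.univ) fun j _ => P.mul_mem_right (h ^ j.val) (hQt j)
      simp only [sub_mul, Finset.sum_sub_distrib] at h1
      rw [hrel, zero_sub, neg_mem_iff] at h1
      rw [Finset.mul_sum]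
      simpa only [mul_assoc] using h1
    have hmem := (hprime.mem_or_mem hsum).resolve_left fun h1 => htP (hprime.mem_of_pow_mem _ h1)
    have hev := (mem_vanishingIdeal_singleton_iff _ _).1 (hPa hmem)
    have hta : eval a t = 0 := by simp [t, ha i₀]
    rw [Multiset.mem_toFinset, Polynomial.mem_roots hW, Polynomial.IsRoot]
    rw [aeval_eq_eval] at hev
    simp only [W, Polynomial.eval_finsetSum, Polynomial.eval_mul, Polynomial.eval_C,
      Polynomial.eval_pow, Polynomial.eval_X]
    rw [← hev]
    simp only [map_sum, map_mul, map_pow]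
    refine Finset.sum_congr rfl fun j _ => ?_
    congr 1
    rw [← aeval_eq_eval, ← Polynomial.aeval_algHom_apply, aeval_eq_eval, hta, hR' j]
    simp [Polynomial.coeff_X_pow_mul', Polynomial.coeff_zero_eq_aeval_zero]
  calc {x | ∀ i, eval x (f i) = 0}.ncard
      ≤ (W.roots.toFinset : Set K).ncard :=
        Set.ncard_le_ncard_of_injOn _ hroot hinj (Finset.finite_toSet _)
    _ ≤ W.roots.card := by rw [Set.ncard_coe_finset]; exact Multiset.toFinset_card_le _
    _ ≤ W.natDegree := Polynomial.card_roots' _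
    _ ≤ ∏ i, d i := hWdeg

end Bezout

section Tangents

open MvPolynomial

variable {n : ℕ}

/-- The pair `(v, p)` represents the line `p + ℂ v`, with `v·v = 1` and `v·p = 0`, tangent to the
sphere of squared radius `ρ` about the origin. If `s i` is `ρ` minus the squared radius of the sphere
with center `w i`, the last condition expresses tangency to that sphere. -/
def IsNormalTangent {ι : Type*} (w : ι → Fin n → ℂ) (s : ι → ℂ) (ρ : ℂ) (v p : Fin n → ℂ) : Prop :=
  v ⬝ᵥ v = 1 ∧ v ⬝ᵥ p = 0 ∧ p ⬝ᵥ p = ρ ∧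
    ∀ i, w i ⬝ᵥ p = (s i + w i ⬝ᵥ w i - (w i ⬝ᵥ v) ^ 2) / 2

/-- The quadratic polynomial in `v` that gives the product `w·p` for normalized tangents. -/
noncomputable def offsetPoly (w : Fin n → ℂ) (s : ℂ) : MvPolynomial (Fin n) ℂ :=
  C (1 / 2) * (C (s + w ⬝ᵥ w) - (∑ k, C (w k) * X k) ^ 2)

lemma eval_offsetPoly (w v : Fin n → ℂ) (s : ℂ) :
    eval v (offsetPoly w s) = (s + w ⬝ᵥ w - (w ⬝ᵥ v) ^ 2) / 2 := by
  simp only [offsetPoly, map_mul, map_sub, map_pow, map_sum, eval_C, eval_X, dotProduct]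
  ring

lemma totalDegree_sum_C_mul_le {σ ι : Type*} [Fintype ι] (a : ι → ℂ) (f : ι → MvPolynomial σ ℂ)
    (d : ℕ) (hf : ∀ i, (f i).totalDegree ≤ d) : (∑ i, C (a i) * f i).totalDegree ≤ d :=
  totalDegree_finsetSum_le fun i _ => (totalDegree_mul _ _).trans <| by
    rw [totalDegree_C, zero_add]; exact hf i

lemma totalDegree_sum_mul_le {σ ι : Type*} [Fintype ι] (f g : ι → MvPolynomial σ ℂ) {d e : ℕ}
    (hf : ∀ i, (f i).totalDegree ≤ d) (hg : ∀ i, (g i).totalDegree ≤ e) :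
    (∑ i, f i * g i).totalDegree ≤ d + e :=
  totalDegree_finsetSum_le fun i _ => (totalDegree_mul _ _).trans (add_le_add (hf i) (hg i))

lemma totalDegree_offsetPoly_le (w : Fin n → ℂ) (s : ℂ) : (offsetPoly w s).totalDegree ≤ 2 := by
  refine (totalDegree_mul _ _).trans ?_
  rw [totalDegree_C, zero_add]
  refine (totalDegree_sub _ _).trans (max_le (by rw [totalDegree_C]; omega) ((totalDegree_pow _ _).trans ?_))
  have := totalDegree_sum_C_mul_le w X 1 fun i => (totalDegree_X i).le
  omega

/-- The foot point `p` as a vector of quadratic polynomials in `v`, where `B` is inverse to the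
matrix with rows `w l`. -/
noncomputable def footPoly (B : Matrix (Fin n) (Fin n) ℂ) (w : Fin n → Fin n → ℂ) (s : Fin n → ℂ)
    (k : Fin n) : MvPolynomial (Fin n) ℂ :=
  ∑ l, C (B k l) * offsetPoly (w l) (s l)

/-- The polynomial system in `v` equivalent to the existence of a normalized tangent. -/
noncomputable def tangentSystem {J : Type*} (P : Fin n → MvPolynomial (Fin n) ℂ)
    (w : J → Fin n → ℂ) (s : J → ℂ) (ρ : ℂ) : J ⊕ Fin 3 → MvPolynomial (Fin n) ℂ :=
  Sum.elim (fun j => (∑ k, C (w j k) * P k) - offsetPoly (w j) (s j))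
    ![(∑ k, X k * X k) - C 1, ∑ k, X k * P k, (∑ k, P k * P k) - C ρ]

lemma ncard_zeros_le_prod_degree_of_equiv {ι σ K : Type*} [Fintype ι] [Fintype σ] [Field K]
    [IsAlgClosed K] (e : σ ≃ ι) (f : ι → MvPolynomial σ K) (d : ι → ℕ)
    (hd : ∀ i, 0 < d i) (hf : ∀ i, (f i).totalDegree ≤ d i)
    (hfin : {x | ∀ i, eval x (f i) = 0}.Finite) :
    {x | ∀ i, eval x (f i) = 0}.ncard ≤ ∏ i, d i := by
  have hZ : {x | ∀ i, eval x (f i) = 0} = {x | ∀ i, eval x (f (e i)) = 0} := by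
    ext x; exact ⟨fun h i => h _, fun h i => by simpa using h (e.symm i)⟩
  rw [hZ] at hfin ⊢
  rw [← e.prod_comp]
  exact ncard_zeros_le_prod_degree (fun i => f (e i)) (fun i => d (e i)) (fun i => hd _)
    (fun i => hf _) hfin

lemma ncard_normalTangent_le {ι : Type*} [Fintype ι] (hn : 3 ≤ n)
    (hcard : Fintype.card ι = 2 * n - 2) (w : ι → Fin n → ℂ) (s : ι → ℂ) (ρ : ℂ) (i₀ : ι)
    (hw₀ : w i₀ = 0) (hs₀ : s i₀ = 0) (a : Fin n → ι) (ha : Function.Injective a)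
    (hu : IsUnit (Matrix.of (w ∘ a)))
    (hfin : {v | ∃ p, IsNormalTangent w s ρ v p}.Finite) :
    {v | ∃ p, IsNormalTangent w s ρ v p}.ncard ≤ 3 * 2 ^ n := by
  classical
  have hdet : IsUnit (Matrix.of (w ∘ a)).det := (Matrix.isUnit_iff_isUnit_det _).1 hu
  have hi₀ : i₀ ∉ Set.range a := by
    rintro ⟨l, hl⟩
    refine hdet.ne_zero (Matrix.det_eq_zero_of_row_eq_zero l fun k => ?_)
    simp [hl, hw₀]
  let J := {i : ι // i ∉ insert i₀ (Finset.univ.image a)}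
  have hJ : Fintype.card J = n - 3 := by
    have h1 : (insert i₀ (Finset.univ.image a)).card = n + 1 := by
      rw [Finset.card_insert_of_notMem (by simpa using hi₀), Finset.card_image_of_injective _ ha]
      simp
    rw [Fintype.card_subtype_compl, hcard, Fintype.card_coe, h1]
    omega
  let B := (Matrix.of (w ∘ a))⁻¹
  let P := footPoly B (w ∘ a) (s ∘ a)
  let F := tangentSystem P (fun j : J => w j) (fun j : J => s j) ρ
  have hPdeg : ∀ k, (P k).totalDegree ≤ 2 := fun k =>
    totalDegree_sum_C_mul_le _ _ _ fun l => totalDegree_offsetPoly_le _ _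
  have hPeval : ∀ v, (fun k => eval v (P k)) =
      B.mulVec fun l => (s (a l) + w (a l) ⬝ᵥ w (a l) - (w (a l) ⬝ᵥ v) ^ 2) / 2 := by
    intro v
    funext k
    simp only [P, footPoly, map_sum, map_mul, eval_C, eval_offsetPoly, Matrix.mulVec,
      Function.comp_apply]
    rfl
  have hfoot : ∀ v p, (∀ l, w (a l) ⬝ᵥ p =
      (s (a l) + w (a l) ⬝ᵥ w (a l) - (w (a l) ⬝ᵥ v) ^ 2) / 2) ↔ p = fun k => eval v (P k) := by
    intro v p
    rw [hPeval, ← funext_iff (f := fun l => w (a l) ⬝ᵥ p)]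
    change (Matrix.of (w ∘ a)).mulVec p = _ ↔ _
    constructor
    · intro h
      rw [← h, Matrix.mulVec_mulVec, Matrix.nonsing_inv_mul _ hdet, Matrix.one_mulVec]
    · rintro rfl
      rw [Matrix.mulVec_mulVec, Matrix.mul_nonsing_inv _ hdet, Matrix.one_mulVec]
  have hZ : {v | ∃ p, IsNormalTangent w s ρ v p} = {v | ∀ i, eval v (F i) = 0} := by
    ext v
    have hsys : (∀ i, eval v (F i) = 0) ↔
        (∀ j : J, w j ⬝ᵥ (fun k => eval v (P k)) =
          (s j + w j ⬝ᵥ w j - (w j ⬝ᵥ v) ^ 2) / 2) ∧ v ⬝ᵥ v = 1 ∧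
        v ⬝ᵥ (fun k => eval v (P k)) = 0 ∧
        (fun k => eval v (P k)) ⬝ᵥ (fun k => eval v (P k)) = ρ := by
      simp [F, tangentSystem, Fin.forall_fin_succ, eval_offsetPoly, sub_eq_zero, dotProduct]
    rw [Set.mem_ofPred_eq, Set.mem_ofPred_eq, hsys]
    constructor
    · rintro ⟨p, h1, h2, h3, h4⟩
      obtain rfl := (hfoot v p).1 fun l => h4 (a l)
      exact ⟨fun j => h4 j, h1, h2, h3⟩
    · rintro ⟨h4, h1, h2, h3⟩
      refine ⟨_, h1, h2, h3, fun i => ?_⟩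
      by_cases hi : i ∈ insert i₀ (Finset.univ.image a)
      · rcases Finset.mem_insert.1 hi with rfl | hi
        · simp [hw₀, hs₀]
        · obtain ⟨l, -, rfl⟩ := Finset.mem_image.1 hi
          exact (hfoot v _).2 rfl l
      · exact h4 ⟨i, hi⟩
  have e : Fin n ≃ J ⊕ Fin 3 := Fintype.equivOfCardEq (by simp [hJ]; omega)
  have hdeg : ∀ i, (F i).totalDegree ≤ (Sum.elim (fun _ : J => 2) ![2, 3, 4] : J ⊕ Fin 3 → ℕ) i := by
    have hX : ∀ k : Fin n, (X k : MvPolynomial (Fin n) ℂ).totalDegree ≤ 1 :=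
      fun k => (totalDegree_X k).le
    rintro (j | j)
    · exact (totalDegree_sub _ _).trans
        (max_le (totalDegree_sum_C_mul_le _ _ _ hPdeg) (totalDegree_offsetPoly_le _ _))
    · fin_cases j
      · exact (totalDegree_sub _ _).trans (max_le (totalDegree_sum_mul_le _ _ hX hX) (by simp))
      · exact totalDegree_sum_mul_le _ _ hX hPdeg
      · exact (totalDegree_sub _ _).trans
          (max_le (totalDegree_sum_mul_le _ _ hPdeg hPdeg) (by simp))
  rw [hZ] at hfin ⊢
  refine (ncard_zeros_le_prod_degree_of_equiv e F _ ?_ hdeg hfin).trans ?_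
  · rintro (j | j)
    · simp
    · fin_cases j <;> simp
  · obtain ⟨m, rfl⟩ := Nat.exists_eq_add_of_le hn
    rw [Fintype.prod_sum_type]
    simp [hJ, Fin.prod_univ_three, pow_add]
    omega


lemma tangency_reparametrize (v x : Fin n → ℂ) (t l : ℂ) (hl : l ≠ 0) (ρ : ℂ) :
    ((l • v) ⬝ᵥ (x + t • v)) ^ 2 = ((l • v) ⬝ᵥ (l • v)) * ((x + t • v) ⬝ᵥ (x + t • v) - ρ) ↔
      (v ⬝ᵥ x) ^ 2 = (v ⬝ᵥ v) * (x ⬝ᵥ x - ρ) := by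
  simp only [smul_dotProduct, dotProduct_smul, dotProduct_add, add_dotProduct, smul_eq_mul,
    dotProduct_comm x v]
  rw [← sub_eq_zero, ← sub_eq_zero (a := (v ⬝ᵥ x) ^ 2)]
  have : (l * (v ⬝ᵥ x + t * (v ⬝ᵥ v))) ^ 2 - l * (l * (v ⬝ᵥ v)) *
      (x ⬝ᵥ x + t * (v ⬝ᵥ x) + (t * (v ⬝ᵥ x + t * (v ⬝ᵥ v))) - ρ) =
      l ^ 2 * ((v ⬝ᵥ x) ^ 2 - (v ⬝ᵥ v) * (x ⬝ᵥ x - ρ)) := by ring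
  constructor
  · intro h
    refine (mul_eq_zero.1 (this.symm.trans ?_)).resolve_left (pow_ne_zero 2 hl)
    rw [← h]; ring
  · intro h
    rw [h, mul_zero] at this
    rw [← this]; ring

lemma isTangentLine_mk'_iff (q v c : Fin n → ℂ) (hv : v ≠ 0) (r : ℝ) :
    IsTangentLine (AffineSubspace.mk' q (ℂ ∙ v)) c r ↔
      (v ⬝ᵥ (q - c)) ^ 2 = (v ⬝ᵥ v) * ((q - c) ⬝ᵥ (q - c) - (r : ℂ) ^ 2) := by
  constructor
  · rintro ⟨p, hp, d, hd, hd0, h⟩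
    rw [AffineSubspace.direction_mk', Submodule.mem_span_singleton] at hd
    rw [AffineSubspace.mem_mk', vsub_eq_sub, Submodule.mem_span_singleton] at hp
    obtain ⟨l, rfl⟩ := hd
    obtain ⟨t, ht⟩ := hp
    have hl : l ≠ 0 := by rintro rfl; simp at hd0
    have hpc : p - c = (q - c) + t • v := by rw [ht]; abel
    rw [hpc] at h
    exact (tangency_reparametrize v (q - c) t l hl _).1 h
  · intro h
    exact ⟨q, AffineSubspace.self_mem_mk' _ _, v, by
      rw [AffineSubspace.direction_mk']; exact Submodule.mem_span_singleton_self v, hv, h⟩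

/-- For normalized representatives, `IsNormalTangent` says that the line is tangent to every
sphere with center `c₀ + w i` and radius `r i`. -/
lemma isNormalTangent_iff {ι : Type*} (w : ι → Fin n → ℂ) (r : ι → ℝ) (c₀ : Fin n → ℂ) (i₀ : ι)
    (hw₀ : w i₀ = 0) (v p : Fin n → ℂ) (hv : v ⬝ᵥ v = 1) (hvp : v ⬝ᵥ p = 0) :
    IsNormalTangent w (fun i => (r i₀ : ℂ) ^ 2 - (r i : ℂ) ^ 2) ((r i₀ : ℂ) ^ 2) v p ↔
      ∀ i, IsTangentLine (AffineSubspace.mk' (c₀ + p) (ℂ ∙ v)) (c₀ + w i) (r i) := by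
  have hv0 : v ≠ 0 := by rintro rfl; simp at hv
  simp only [isTangentLine_mk'_iff _ _ _ hv0, add_sub_add_left_eq_sub, hv, one_mul,
    dotProduct_sub, sub_dotProduct, hvp, IsNormalTangent, true_and, zero_sub]
  simp only [dotProduct_comm v, dotProduct_comm p (w _)]
  constructor
  · rintro ⟨hp, h⟩ i
    rw [h i, hp]; ring
  · intro h
    have hp : p ⬝ᵥ p = (r i₀ : ℂ) ^ 2 := by
      have := h i₀
      simp only [hw₀, zero_dotProduct] at this
      linear_combination -this
    refine ⟨hp, fun i => ?_⟩
    have := h i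
    rw [hp] at this
    linear_combination (1 / 2) * this

/-- Every common tangent line has a normalized representative. -/
lemma exists_normalTangent {ι : Type*} (w : ι → Fin n → ℂ) (r : ι → ℝ) (c₀ : Fin n → ℂ) (i₀ : ι)
    (hw₀ : w i₀ = 0) (hw : ∀ x, (∀ i, w i ⬝ᵥ x = 0) → x = 0)
    (L : AffineSubspace ℂ (Fin n → ℂ)) (hL : Module.finrank ℂ L.direction = 1)
    (ht : ∀ i, IsTangentLine L (c₀ + w i) (r i)) :
    ∃ v p, IsNormalTangent w (fun i => (r i₀ : ℂ) ^ 2 - (r i : ℂ) ^ 2) ((r i₀ : ℂ) ^ 2) v p ∧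
      L = AffineSubspace.mk' (c₀ + p) (ℂ ∙ v) := by
  obtain ⟨q, hq, -⟩ := ht i₀
  obtain ⟨⟨d, hdL⟩, hd0, hd⟩ := finrank_eq_one_iff'.1 hL
  have hd0 : d ≠ 0 := fun h => hd0 (Subtype.ext h)
  have hdir : L.direction = ℂ ∙ d := by
    refine le_antisymm (fun y hy => ?_) ((Submodule.span_singleton_le_iff_mem _ _).2 hdL)
    obtain ⟨t, ht⟩ := hd ⟨y, hy⟩
    exact Submodule.mem_span_singleton.2 ⟨t, congrArg Subtype.val ht⟩
  have hLd : L = AffineSubspace.mk' q (ℂ ∙ d) := by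
    rw [← hdir, AffineSubspace.mk'_eq hq]
  have hD : d ⬝ᵥ d ≠ 0 := by
    intro hD
    have h0 : ∀ i, d ⬝ᵥ (q - (c₀ + w i)) = 0 := by
      intro i
      have := ht i
      rw [hLd, isTangentLine_mk'_iff _ _ _ hd0, hD, zero_mul] at this
      exact pow_eq_zero_iff two_ne_zero |>.1 this
    refine hd0 (hw d fun i => ?_)
    have h1 := h0 i
    have h2 := h0 i₀
    rw [hw₀, add_zero] at h2
    rw [← sub_sub, dotProduct_sub, h2, zero_sub, neg_eq_zero] at h1
    rw [dotProduct_comm, h1]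
  obtain ⟨s, hs⟩ := IsAlgClosed.exists_pow_nat_eq (d ⬝ᵥ d) two_pos
  have hs0 : s ≠ 0 := by rintro rfl; exact hD (by rw [← hs]; simp)
  set v := s⁻¹ • d with hvdef
  set p := (q - c₀) - (v ⬝ᵥ (q - c₀)) • v with hpdef
  have hv : v ⬝ᵥ v = 1 := by
    rw [hvdef, smul_dotProduct, dotProduct_smul, smul_eq_mul, smul_eq_mul, ← hs]
    field_simp
  have hvp : v ⬝ᵥ p = 0 := by
    rw [hpdef, dotProduct_sub, dotProduct_smul, hv, smul_eq_mul, mul_one, sub_self]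
  have hspan : (ℂ ∙ v) = ℂ ∙ d :=
    Submodule.span_singleton_smul_eq (IsUnit.mk0 _ (inv_ne_zero hs0)) d
  have hLv : L = AffineSubspace.mk' (c₀ + p) (ℂ ∙ v) := by
    have hmem : c₀ + p ∈ L := by
      rw [hLd, AffineSubspace.mem_mk', ← hspan, Submodule.mem_span_singleton]
      refine ⟨-(v ⬝ᵥ (q - c₀)), ?_⟩
      rw [hpdef, vsub_eq_sub, neg_smul]
      abel
    rw [hspan, ← hdir, AffineSubspace.mk'_eq hmem]
  exact ⟨v, p, (isNormalTangent_iff w r c₀ i₀ hw₀ v p hv hvp).2 (hLv ▸ ht), hLv⟩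

lemma finite_and_ncard_le_of_two_to_one {α β : Type*} [Nonempty α] (T : Set β) (Z : Set α) (φ : α → β)
    (σ : α → α) (hmaps : ∀ z ∈ Z, φ z ∈ T) (hsurj : ∀ t ∈ T, ∃ z ∈ Z, φ z = t)
    (hσ : ∀ z ∈ Z, σ z ∈ Z ∧ φ (σ z) = φ z ∧ σ z ≠ z)
    (hfib : ∀ z ∈ Z, ∀ z' ∈ Z, φ z = φ z' → z' = z ∨ z' = σ z) (hT : T.Finite) :
    Z.Finite ∧ 2 * T.ncard ≤ Z.ncard := by
  choose! g hg using hsurj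
  have hZfin : Z.Finite := by
    refine ((hT.image g).union (hT.image (σ ∘ g))).subset fun z hz => ?_
    have ht := hmaps z hz
    rcases hfib _ (hg _ ht).1 z hz (hg _ ht).2 with h | h
    · exact Or.inl ⟨φ z, ht, h.symm⟩
    · exact Or.inr ⟨φ z, ht, h.symm⟩
  refine ⟨hZfin, ?_⟩
  have hσg : ∀ t ∈ T, φ (σ (g t)) = t := fun t ht =>
    ((hσ _ (hg t ht).1).2.1).trans (hg t ht).2
  have h1 : Set.InjOn g T := fun t ht t' ht' h => by
    rw [← (hg t ht).2, h, (hg t' ht').2]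
  have h2 : Set.InjOn (σ ∘ g) T := fun t ht t' ht' h => by
    rw [← hσg t ht, ← hσg t' ht']; exact congrArg φ h
  have hdisj : Disjoint (g '' T) ((σ ∘ g) '' T) := by
    rw [Set.disjoint_left]
    rintro _ ⟨t, ht, rfl⟩ ⟨t', ht', h⟩
    have htt : t' = t := by rw [← hσg t' ht', ← (hg t ht).2]; exact congrArg φ h
    subst htt
    exact (hσ _ (hg t' ht).1).2.2 h
  calc 2 * T.ncard = (g '' T ∪ (σ ∘ g) '' T).ncard := by
        rw [Set.ncard_union_eq hdisj (hT.image _) (hT.image _), h1.ncard_image, h2.ncard_image, two_mul]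
    _ ≤ Z.ncard := by
        refine Set.ncard_le_ncard ?_ hZfin
        rintro _ (⟨t, ht, rfl⟩ | ⟨t, ht, rfl⟩)
        · exact (hg t ht).1
        · exact (hσ _ (hg t ht).1).1

/-- Among differences of points affinely spanning `ℝⁿ` one can choose a basis, and it stays
a basis over `ℂ`. -/
lemma exists_isUnit_of_affineSpan_eq_top {ι : Type*} (c : ι → Fin n → ℝ)
    (hspan : affineSpan ℝ (Set.range c) = ⊤) (i₀ : ι) :
    ∃ a : Fin n → ι, Function.Injective a ∧
      IsUnit (Matrix.of fun l k => ((c (a l) k : ℂ) - (c i₀ k : ℂ))) := by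
  have hw : Submodule.span ℝ (Set.range fun i => c i - c i₀) = ⊤ := by
    rw [← AffineSubspace.vectorSpan_eq_top_of_affineSpan_eq_top ℝ _ _ hspan,
      vectorSpan_range_eq_span_range_vsub_right ℝ c i₀]
    rfl
  obtain ⟨κ, b, hb, hbs, hli⟩ := exists_linearIndependent' ℝ fun i => c i - c i₀
  rw [hw] at hbs
  let bas := Module.Basis.mk hli hbs.ge
  let e : κ ≃ Fin n := bas.indexEquiv (Pi.basisFun ℝ (Fin n))
  refine ⟨b ∘ e.symm, hb.comp e.symm.injective, ?_⟩
  have hli' := hli.comp e.symm e.symm.injective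
  have h1 : IsUnit (Matrix.of fun l k => c (b (e.symm l)) k - c i₀ k) :=
    Matrix.linearIndependent_rows_iff_isUnit.1 hli'
  have h2 := h1.map (Complex.ofRealHom.mapMatrix)
  convert h2 using 1
  ext l k
  simp

end Tangents

/-- if `2n−2` spheres in `ℝⁿ` (`n ≥ 3`) with centers affinely spanning `ℝⁿ`
have finitely many complex common tangent lines, then there are at most `3·2^{n−1}` of them. -/
theorem card_tangents_le (n : ℕ) (hn : 3 ≤ n) (c : Fin (2 * n - 2) → (Fin n → ℝ))
    (hspan : affineSpan ℝ (Set.range c) = ⊤)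
    (r : Fin (2 * n - 2) → ℝ) (hr : ∀ i, 0 < r i) :
    (({L | Module.finrank ℂ L.direction = 1 ∧
        ∀ i, IsTangentLine L (fun j => (c i j : ℂ)) (r i)} :
          Set (AffineSubspace ℂ (Fin n → ℂ))).Finite) →
      ({L | Module.finrank ℂ L.direction = 1 ∧
        ∀ i, IsTangentLine L (fun j => (c i j : ℂ)) (r i)} :
          Set (AffineSubspace ℂ (Fin n → ℂ))).ncard ≤ 3 * 2 ^ (n - 1) := by
  intro hT
  let i₀ : Fin (2 * n - 2) := ⟨0, by omega⟩
  let c₀ : Fin n → ℂ := fun k => c i₀ k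
  let w : Fin (2 * n - 2) → Fin n → ℂ := fun i k => (c i k : ℂ) - c i₀ k
  have hw₀ : w i₀ = 0 := by funext k; simp [w]
  have hcw : ∀ i, (fun k => (c i k : ℂ)) = c₀ + w i := fun i => by funext k; simp [c₀, w]
  simp only [hcw] at hT ⊢
  set T : Set (AffineSubspace ℂ (Fin n → ℂ)) :=
    {L | Module.finrank ℂ L.direction = 1 ∧ ∀ i, IsTangentLine L (c₀ + w i) (r i)}
  obtain ⟨a, ha, hu⟩ := exists_isUnit_of_affineSpan_eq_top c hspan i₀
  have hu : IsUnit (Matrix.of (w ∘ a)) := hu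
  have hw : ∀ x, (∀ i, w i ⬝ᵥ x = 0) → x = 0 := fun x hx =>
    Matrix.mulVec_injective_of_isUnit hu <| by
      rw [Matrix.mulVec_zero]
      funext l
      exact hx (a l)
  let N := IsNormalTangent w (fun i => (r i₀ : ℂ) ^ 2 - (r i : ℂ) ^ 2) ((r i₀ : ℂ) ^ 2)
  have huniq : ∀ {v p p'}, N v p → N v p' → p = p' := fun h h' =>
    sub_eq_zero.1 <| hw _ fun i => by
      rw [dotProduct_sub, h.2.2.2 i, h'.2.2.2 i, sub_self]
  have hneg : ∀ {v p}, N v p → N (-v) p := fun {v p} h => by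
    obtain ⟨h1, h2, h3, h4⟩ := h
    exact ⟨by simpa using h1, by simpa using h2, h3, by simpa using h4⟩
  have hN0 : ∀ {v p}, N v p → v ≠ 0 := by
    rintro v p h rfl
    simpa using h.1
  have hfoot : ∃ P : (Fin n → ℂ) → Fin n → ℂ, ∀ v, (∃ p, N v p) → N v (P v) := by
    choose! P hP using fun (v : Fin n → ℂ) (h : ∃ p, N v p) => h
    exact ⟨P, hP⟩
  obtain ⟨P, hP⟩ := hfoot
  suffices h : {v | ∃ p, N v p}.Finite ∧ 2 * T.ncard ≤ {v | ∃ p, N v p}.ncard by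
    have h1 : {v | ∃ p, N v p}.ncard ≤ 3 * 2 ^ n :=
      ncard_normalTangent_le hn (by simp) w _ _ i₀ hw₀ (by simp) a ha hu h.1
    have h2 : 2 ^ n = 2 * 2 ^ (n - 1) := by rw [← pow_succ']; congr 1; omega
    have h3 := h.2
    omega
  refine finite_and_ncard_le_of_two_to_one _ {v | ∃ p, N v p}
    (fun v => AffineSubspace.mk' (c₀ + P v) (ℂ ∙ v)) (fun v => -v) ?_ ?_ ?_ ?_ hT
  · intro v hv
    have h := hP v hv
    refine ⟨?_, (isNormalTangent_iff w r c₀ i₀ hw₀ v _ h.1 h.2.1).1 h⟩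
    rw [AffineSubspace.direction_mk']
    exact finrank_span_singleton (hN0 h)
  · rintro L ⟨hL, ht⟩
    obtain ⟨v, p, h, rfl⟩ := exists_normalTangent w r c₀ i₀ hw₀ hw L hL ht
    exact ⟨v, ⟨p, h⟩, by rw [huniq (hP v ⟨p, h⟩) h]⟩
  · rintro v ⟨p, h⟩
    refine ⟨⟨p, hneg h⟩, ?_, fun hv => hN0 h (self_eq_neg.1 hv.symm)⟩
    rw [huniq (hP v ⟨p, h⟩) h, huniq (hP (-v) ⟨p, hneg h⟩) (hneg h), ← Set.neg_singleton,
      Submodule.span_neg]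
  · rintro v ⟨p, h⟩ v' ⟨p', h'⟩ heq
    have hdir := congrArg AffineSubspace.direction heq
    simp only [AffineSubspace.direction_mk'] at hdir
    obtain ⟨t, rfl⟩ := Submodule.mem_span_singleton.1
      (hdir ▸ Submodule.mem_span_singleton_self v' : v' ∈ ℂ ∙ v)
    have ht : t * t = 1 := by
      have := h'.1
      rwa [smul_dotProduct, dotProduct_smul, h.1, smul_eq_mul, smul_eq_mul, mul_one] at this
    rcases mul_self_eq_one_iff.1 ht with rfl | rfl
    · exact Or.inl (one_smul _ _)
    · exact Or.inr (neg_one_smul _ _)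
end

section
/- For every n ≥ 3 there exist points c_1, …, c_{2n−2} ∈ ℝ^n such that the set of one-dimensional affine subspaces ℓ of ℝ^n whose Euclidean distance from c_i equals 1 for every i = 1, …, 2n−2 is finite and has exactly 3·2^{n−1} elements. (That is, there is a configuration of 2n−2 unit spheres in ℝ^n with exactly 3·2^{n−1} real common tangent lines.) -/
open Metric

section Lines

variable {E : Type*} [NormedAddCommGroup E] [InnerProductSpace ℝ E]

/-- The line through `p` in direction `w`. -/
noncomputable abbrev lineThrough (p w : E) : AffineSubspace ℝ E := AffineSubspace.mk' p (ℝ ∙ w)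

theorem infDist_lineThrough_eq_one_iff {p w : E} (hw : w ≠ 0) (hpw : inner ℝ p w = 0) (c : E) :
    infDist c (lineThrough p w : Set E) = 1 ↔
      ‖w‖ ^ 2 * (‖p‖ ^ 2 - 2 * inner ℝ p c + ‖c‖ ^ 2 - 1) = inner ℝ w c ^ 2 := by
  have : (lineThrough p w).direction.HasOrthogonalProjection := by
    rw [AffineSubspace.direction_mk']
    infer_instance
  set q := EuclideanGeometry.orthogonalProjection (lineThrough p w) c with hq
  have h1 : dist c q = infDist c (lineThrough p w : Set E) :=
    EuclideanGeometry.dist_orthogonalProjection_eq_infDist _ _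
  have hqm : (q : E) ∈ lineThrough p w := q.2
  obtain ⟨t, ht⟩ : ∃ t : ℝ, t • w = (q : E) - p := by
    rw [AffineSubspace.mem_mk', Submodule.mem_span_singleton] at hqm
    simpa using hqm
  have hort : inner ℝ w (c - q) = 0 := by
    have := EuclideanGeometry.vsub_orthogonalProjection_mem_direction_orthogonal
      (lineThrough p w) c
    exact (Submodule.mem_orthogonal _ _).1 this w
      ((AffineSubspace.direction_mk' p (ℝ ∙ w)).symm ▸ Submodule.mem_span_singleton_self w)
  have hqe : (q : E) = p + t • w := by rw [ht]; abel
  have hwp : inner ℝ w p = 0 := by rw [real_inner_comm]; exact hpw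
  rw [← h1, dist_eq_norm, hqe]
  rw [hqe] at hort
  have hw2 : 0 < ‖w‖ ^ 2 := by positivity
  have h2 : inner ℝ w c = t * ‖w‖ ^ 2 := by
    rw [inner_sub_right, inner_add_right, inner_smul_right, real_inner_self_eq_norm_sq, hwp] at hort
    linarith
  have h3 : ‖c - (p + t • w)‖ ^ 2 = ‖p‖ ^ 2 - 2 * inner ℝ p c + ‖c‖ ^ 2 - t ^ 2 * ‖w‖ ^ 2 := by
    rw [norm_sub_sq_real, norm_add_sq_real, inner_add_right, inner_smul_right, inner_smul_right,
      real_inner_comm w c, h2, hpw, norm_smul, real_inner_comm p c, mul_pow, Real.norm_eq_abs,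
      sq_abs]
    ring
  rw [← sq_eq_sq₀ (norm_nonneg _) zero_le_one, h3, h2]
  constructor
  · intro h; linear_combination ‖w‖ ^ 2 * h
  · intro h; apply mul_left_cancel₀ hw2.ne'; linear_combination h

theorem exists_eq_lineThrough [FiniteDimensional ℝ E] {ℓ : AffineSubspace ℝ E}
    (h : Module.finrank ℝ ℓ.direction = 1) {r : ℝ} (hr : 0 < r) :
    ∃ p w : E, ‖w‖ = r ∧ inner ℝ p w = 0 ∧ ℓ = lineThrough p w := by
  obtain ⟨v, hv, hspan⟩ := finrank_eq_one_iff'.1 h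
  have hne : (ℓ : Set E).Nonempty := by
    by_contra hne
    rw [Set.not_nonempty_iff_eq_empty, AffineSubspace.coe_eq_bot_iff] at hne
    rw [hne, AffineSubspace.direction_bot, finrank_bot] at h
    exact zero_ne_one h
  have : Nonempty ℓ := hne.to_subtype
  have hv0 : (v : E) ≠ 0 := fun h0 => hv (Subtype.ext h0)
  have hk : r / ‖(v : E)‖ ≠ 0 := by positivity
  have hdir : ℓ.direction = ℝ ∙ (v : E) := by
    apply le_antisymm
    · intro x hx
      obtain ⟨c, hc⟩ := hspan ⟨x, hx⟩
      exact Submodule.mem_span_singleton.2 ⟨c, congrArg Subtype.val hc⟩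
    · rw [Submodule.span_singleton_le_iff_mem]; exact v.2
  refine ⟨EuclideanGeometry.orthogonalProjection ℓ 0, (r / ‖(v : E)‖) • (v : E), ?_, ?_, ?_⟩
  · rw [norm_smul, norm_div, norm_norm, Real.norm_of_nonneg hr.le,
      div_mul_cancel₀ _ (norm_ne_zero_iff.2 hv0)]
  · have := EuclideanGeometry.vsub_orthogonalProjection_mem_direction_orthogonal ℓ (0 : E)
    have := (Submodule.mem_orthogonal' _ _).1 this _ v.2
    simp only [vsub_eq_sub, zero_sub, inner_neg_left, neg_eq_zero] at this
    rw [inner_smul_right, this, mul_zero]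
  · rw [lineThrough, Submodule.span_singleton_smul_eq (IsUnit.mk0 _ hk), ← hdir,
      AffineSubspace.mk'_eq (EuclideanGeometry.orthogonalProjection_mem _)]

theorem finrank_direction_lineThrough (p : E) {w : E} (hw : w ≠ 0) :
    Module.finrank ℝ (lineThrough p w).direction = 1 := by
  rw [AffineSubspace.direction_mk', finrank_span_singleton hw]

theorem eq_or_eq_neg_of_lineThrough_eq {p w p' w' : E} (hw : w ≠ 0) (hn : ‖w‖ = ‖w'‖)
    (h : lineThrough p w = lineThrough p' w') : w' = w ∨ w' = -w := by
  have hd := congrArg AffineSubspace.direction h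
  rw [AffineSubspace.direction_mk', AffineSubspace.direction_mk'] at hd
  obtain ⟨k, rfl⟩ := Submodule.mem_span_singleton.1 (hd ▸ Submodule.mem_span_singleton_self w')
  rw [norm_smul, eq_comm, mul_eq_right₀ (norm_ne_zero_iff.2 hw), Real.norm_eq_abs] at hn
  rcases eq_or_eq_neg_of_abs_eq hn with rfl | rfl <;> simp

end Lines

/-- The twelve integer triples `(0, ±1, ±2)`, up to permutation and modulo a global sign: the first
component of the index is the position of the zero. -/
def baseTriple (t : Fin 3 × Bool × Bool) (k : Fin 3) : ℤ :=
  if k = t.1 then 0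
  else if k = t.1 + 1 then (if t.2.1 then 1 else 2)
  else (if t.2.2 then 1 else -1) * (if t.2.1 then 2 else 1)

theorem baseTriple_injective : Function.Injective baseTriple := by
  have : ∀ s t, (∀ k, baseTriple s k = baseTriple t k) → s = t := by decide
  exact fun s t h => this s t (congrFun h)

theorem baseTriple_ne_neg : ∀ s t, ∃ k, baseTriple s k ≠ -baseTriple t k := by decide

theorem exists_baseTriple_of_mem_Icc : ∀ a ∈ Finset.Icc (-2 : ℤ) 2, ∀ b ∈ Finset.Icc (-2 : ℤ) 2,
    ∀ c ∈ Finset.Icc (-2 : ℤ) 2, a * b * c = 0 → a ^ 2 + b ^ 2 + c ^ 2 = 5 →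
    ∃ t, (∀ k, ![a, b, c] k = baseTriple t k) ∨ (∀ k, ![a, b, c] k = -baseTriple t k) := by
  decide +kernel

theorem baseTriple_prod : ∀ t, baseTriple t 0 * baseTriple t 1 * baseTriple t 2 = 0 := by decide

theorem baseTriple_sum_sq : ∀ t, baseTriple t 0 ^ 2 + baseTriple t 1 ^ 2 + baseTriple t 2 ^ 2 = 5 := by
  decide

theorem baseTriple_sum_prod_sq : ∀ t, (baseTriple t 1 * baseTriple t 2) ^ 2 +
    (baseTriple t 2 * baseTriple t 0) ^ 2 + (baseTriple t 0 * baseTriple t 1) ^ 2 = 4 := by decide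

theorem exists_int_of_sq_roots {z : ℝ} (h : z ^ 2 * (z ^ 2 - 1) * (z ^ 2 - 4) = 0) :
    ∃ a ∈ Finset.Icc (-2 : ℤ) 2, (a : ℝ) = z := by
  have : z * ((z - 1) * ((z + 1) * ((z - 2) * (z + 2)))) = 0 := by
    rw [← pow_eq_zero_iff two_ne_zero]
    linear_combination (z ^ 2 - 1) * (z ^ 2 - 4) * h
  simp only [mul_eq_zero] at this
  rcases this with h | h | h | h | h
  · exact ⟨0, by decide, by push_cast; linarith⟩
  · exact ⟨1, by decide, by push_cast; linarith⟩
  · exact ⟨-1, by decide, by push_cast; linarith⟩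
  · exact ⟨2, by decide, by push_cast; linarith⟩
  · exact ⟨-2, by decide, by push_cast; linarith⟩

theorem exists_baseTriple {x : Fin 3 → ℝ} (h0 : x 0 * x 1 * x 2 = 0)
    (h1 : x 0 ^ 2 + x 1 ^ 2 + x 2 ^ 2 = 5)
    (h2 : (x 1 * x 2) ^ 2 + (x 2 * x 0) ^ 2 + (x 0 * x 1) ^ 2 = 4) :
    ∃ t, (∀ k, x k = baseTriple t k) ∨ (∀ k, x k = -baseTriple t k) := by
  have h : ∀ k, ∃ a ∈ Finset.Icc (-2 : ℤ) 2, (a : ℝ) = x k := by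
    have h0' : x 0 ^ 2 * x 1 ^ 2 * x 2 ^ 2 = 0 := by rw [← mul_pow, ← mul_pow, h0]; norm_num
    intro k
    apply exists_int_of_sq_roots
    fin_cases k <;> simp only [Fin.zero_eta, Fin.mk_one, Fin.reduceFinMk]
    · linear_combination x 0 ^ 4 * h1 - x 0 ^ 2 * h2 + h0'
    · linear_combination x 1 ^ 4 * h1 - x 1 ^ 2 * h2 + h0'
    · linear_combination x 2 ^ 4 * h1 - x 2 ^ 2 * h2 + h0'
  choose y hy hyx using h
  simp only [← hyx] at h0 h1
  norm_cast at h0 h1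
  obtain ⟨t, ht⟩ := exists_baseTriple_of_mem_Icc _ (hy 0) _ (hy 1) _ (hy 2) h0 h1
  have hv : ∀ k, ![y 0, y 1, y 2] k = y k := by intro k; fin_cases k <;> rfl
  simp only [hv] at ht
  refine ⟨t, ht.imp (fun h k => ?_) (fun h k => ?_)⟩ <;> rw [← hyx, h]
  push_cast; rfl

/-- The vertices of a regular tetrahedron centred at the origin. -/
def tetraVertex : Fin 4 → Fin 3 → ℝ :=
  ![![1, 1, 1], ![1, -1, -1], ![-1, 1, -1], ![-1, -1, 1]]

/-- The factor which rescales the configuration to unit spheres. -/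
noncomputable def tetraScale (m : ℕ) : ℝ :=
  (5 * (m + 1)) / √(3 * (5 * (m + 1)) ^ 2 - 5 * (5 * (m + 1)) + 4)

/-- The distance to the origin of the centres on the coordinate axes, before rescaling. -/
noncomputable def axisScale (m : ℕ) : ℝ := √((3 * m + 2) / m)

theorem tetraScale_pos (m : ℕ) : 0 < tetraScale m := by
  have : (0 : ℝ) < 3 * (5 * (m + 1)) ^ 2 - 5 * (5 * (m + 1)) + 4 := by
    nlinarith [m.cast_nonneg (α := ℝ)]
  unfold tetraScale
  positivity

theorem tetraScale_sq (m : ℕ) :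
    tetraScale m ^ 2 * (3 * (5 * (m + 1)) ^ 2 - 5 * (5 * (m + 1)) + 4) = (5 * (m + 1)) ^ 2 := by
  have : (0 : ℝ) < 3 * (5 * (m + 1)) ^ 2 - 5 * (5 * (m + 1)) + 4 := by
    nlinarith [m.cast_nonneg (α := ℝ)]
  rw [tetraScale, div_pow, Real.sq_sqrt this.le, div_mul_cancel₀ _ this.ne']

theorem axisScale_sq {m : ℕ} (hm : m ≠ 0) : m * axisScale m ^ 2 = 3 * m + 2 := by
  rw [axisScale, Real.sq_sqrt (by positivity)]
  field_simp

theorem axisScale_pos {m : ℕ} (hm : m ≠ 0) : 0 < axisScale m := by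
  unfold axisScale
  positivity

/-- The centres: a tetrahedron in the first three coordinates and a pair of opposite points on each of
the other coordinate axes. -/
noncomputable def sphereCenter (m : ℕ) :
    Fin 4 ⊕ Fin m ⊕ Fin m → EuclideanSpace ℝ (Fin (3 + m)) :=
  Sum.elim
    (fun i => WithLp.toLp 2 (Fin.append (tetraScale m • tetraVertex i) 0))
    (Sum.elim
      (fun j => EuclideanSpace.single (Fin.natAdd 3 j) (tetraScale m * axisScale m))
      (fun j => EuclideanSpace.single (Fin.natAdd 3 j) (-(tetraScale m * axisScale m))))

section Coordinates

variable {m : ℕ}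

theorem inner_eq_sum_add_sum (p w : EuclideanSpace ℝ (Fin (3 + m))) :
    inner ℝ p w = p (Fin.castAdd m 0) * w (Fin.castAdd m 0)
      + p (Fin.castAdd m 1) * w (Fin.castAdd m 1) + p (Fin.castAdd m 2) * w (Fin.castAdd m 2)
      + ∑ j : Fin m, p (Fin.natAdd 3 j) * w (Fin.natAdd 3 j) := by
  simp [PiLp.inner_apply, Fin.sum_univ_add, Fin.sum_univ_three, mul_comm]

theorem norm_sq_eq_sum_add_sum (w : EuclideanSpace ℝ (Fin (3 + m))) :
    ‖w‖ ^ 2 = w (Fin.castAdd m 0) ^ 2 + w (Fin.castAdd m 1) ^ 2 + w (Fin.castAdd m 2) ^ 2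
      + ∑ j : Fin m, w (Fin.natAdd 3 j) ^ 2 := by
  rw [← real_inner_self_eq_norm_sq, inner_eq_sum_add_sum]
  simp only [← sq]

theorem inner_toLp_append_zero (w : EuclideanSpace ℝ (Fin (3 + m))) (x : Fin 3 → ℝ) :
    inner ℝ w (WithLp.toLp 2 (Fin.append x 0)) = w (Fin.castAdd m 0) * x 0
      + w (Fin.castAdd m 1) * x 1 + w (Fin.castAdd m 2) * x 2 := by
  rw [inner_eq_sum_add_sum]
  simp only [Fin.append_left, Fin.append_right]
  simp

theorem norm_sq_toLp_append_zero (x : Fin 3 → ℝ) :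
    ‖(WithLp.toLp 2 (Fin.append x 0) : EuclideanSpace ℝ (Fin (3 + m)))‖ ^ 2
      = x 0 ^ 2 + x 1 ^ 2 + x 2 ^ 2 := by
  rw [norm_sq_eq_sum_add_sum]
  simp only [Fin.append_left, Fin.append_right]
  simp

/-- The point closest to the origin on the common tangent with direction `w`. -/
noncomputable def footPoint (w : EuclideanSpace ℝ (Fin (3 + m))) : EuclideanSpace ℝ (Fin (3 + m)) :=
  WithLp.toLp 2 (Fin.append
    (fun k => -(tetraScale m / (5 * (m + 1))) *
      (w (Fin.castAdd m (k + 1)) * w (Fin.castAdd m (k + 2)))) 0)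

/-- The equations satisfied by the directions of common tangents, normalized to have squared norm
`5 * (m + 1)`. -/
structure IsTangentDirection (w : EuclideanSpace ℝ (Fin (3 + m))) : Prop where
  prod_eq_zero : w (Fin.castAdd m 0) * w (Fin.castAdd m 1) * w (Fin.castAdd m 2) = 0
  sum_sq : w (Fin.castAdd m 0) ^ 2 + w (Fin.castAdd m 1) ^ 2 + w (Fin.castAdd m 2) ^ 2 = 5
  sum_prod_sq : (w (Fin.castAdd m 1) * w (Fin.castAdd m 2)) ^ 2
    + (w (Fin.castAdd m 2) * w (Fin.castAdd m 0)) ^ 2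
    + (w (Fin.castAdd m 0) * w (Fin.castAdd m 1)) ^ 2 = 4
  sq_eq_five (j : Fin m) : w (Fin.natAdd 3 j) ^ 2 = 5

theorem IsTangentDirection.norm_sq {w : EuclideanSpace ℝ (Fin (3 + m))}
    (hw : IsTangentDirection w) : ‖w‖ ^ 2 = 5 * (m + 1) := by
  rw [norm_sq_eq_sum_add_sum, hw.sum_sq]
  simp [hw.sq_eq_five]
  ring

theorem footPoint_castAdd (w : EuclideanSpace ℝ (Fin (3 + m))) (k : Fin 3) :
    footPoint w (Fin.castAdd m k) = -(tetraScale m / (5 * (m + 1))) *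
      (w (Fin.castAdd m (k + 1)) * w (Fin.castAdd m (k + 2))) := by
  simp only [footPoint, Fin.append_left]

theorem footPoint_natAdd (w : EuclideanSpace ℝ (Fin (3 + m))) (j : Fin m) :
    footPoint w (Fin.natAdd 3 j) = 0 := by
  simp only [footPoint, Fin.append_right, Pi.zero_apply]

theorem footPoint_neg (w : EuclideanSpace ℝ (Fin (3 + m))) : footPoint (-w) = footPoint w := by
  simp [footPoint]

theorem inner_footPoint (w : EuclideanSpace ℝ (Fin (3 + m))) :
    inner ℝ (footPoint w) w = -(tetraScale m / (5 * (m + 1))) * (3 *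
      (w (Fin.castAdd m 0) * w (Fin.castAdd m 1) * w (Fin.castAdd m 2))) := by
  simp only [inner_eq_sum_add_sum, footPoint_castAdd, footPoint_natAdd]
  simp
  ring

theorem norm_sq_footPoint (w : EuclideanSpace ℝ (Fin (3 + m))) :
    ‖footPoint w‖ ^ 2 = (tetraScale m / (5 * (m + 1))) ^ 2 *
     ((w (Fin.castAdd m 1) * w (Fin.castAdd m 2)) ^ 2
    + (w (Fin.castAdd m 2) * w (Fin.castAdd m 0)) ^ 2
    + (w (Fin.castAdd m 0) * w (Fin.castAdd m 1)) ^ 2) := by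
  simp only [norm_sq_eq_sum_add_sum, footPoint_castAdd, footPoint_natAdd]
  simp
  ring

theorem infDist_sphereCenter_eq_one_iff {p w : EuclideanSpace ℝ (Fin (3 + m))}
    (hw : ‖w‖ ^ 2 = 5 * (m + 1)) (hpw : inner ℝ p w = 0) :
    (∀ i, infDist (sphereCenter m i)
      (lineThrough p w : Set (EuclideanSpace ℝ (Fin (3 + m)))) = 1) ↔
      p = footPoint w ∧ IsTangentDirection w := by
  have hN : (0 : ℝ) < 5 * (m + 1) := by positivity
  have hw0 : w ≠ 0 := by
    rintro rfl
    simp at hw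
    linarith
  have hl := tetraScale_pos m
  have hl2 := tetraScale_sq m
  have ha2 : ∀ j : Fin m, (m : ℝ) * axisScale m ^ 2 = 3 * m + 2 := fun j =>
    axisScale_sq (by have := j.2; omega)
  have ha : ∀ j : Fin m, 0 < axisScale m := fun j => axisScale_pos (by have := j.2; omega)
  simp only [infDist_lineThrough_eq_one_iff hw0 hpw, hw]
  set l := tetraScale m with hl_def
  set a := axisScale m with ha_def
  set N : ℝ := 5 * (m + 1) with hN_def
  simp only [Sum.forall, sphereCenter, Sum.elim_inl, Sum.elim_inr, inner_toLp_append_zero,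
    norm_sq_toLp_append_zero, EuclideanSpace.inner_single_right, PiLp.norm_single,
    Fin.forall_fin_succ (n := 3), Fin.forall_fin_succ (n := 2),
    Fin.forall_fin_succ (n := 1), Fin.forall_fin_succ (n := 0)]
  simp [tetraVertex, ← ha_def, ← hl_def, mul_pow]
  have hw' := norm_sq_eq_sum_add_sum w
  rw [hw] at hw'
  obtain ⟨κ, hκ_def⟩ : ∃ κ, κ = l / N := ⟨_, rfl⟩
  have hκ : N * κ = l := by rw [hκ_def, mul_div_cancel₀ _ hN.ne']
  have hκ0 : κ ≠ 0 := by rw [hκ_def]; positivity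
  have hfc := footPoint_castAdd w
  have hfn := norm_sq_footPoint w
  have hfi := inner_footPoint w
  simp only [← hl_def, ← hN_def, ← hκ_def] at hfc hfn hfi
  constructor
  · rintro ⟨⟨h0, h1, h2, h3⟩, hp, hm⟩
    have hpj (j : Fin m) : p (Fin.natAdd 3 j) = 0 := by
      have : N * l * a ≠ 0 := (mul_pos (mul_pos hN hl) (ha j)).ne'
      apply mul_left_cancel₀ this
      linear_combination (hm j - hp j) / 4
    have hpw' : p = footPoint w := by
      ext i
      have hNl : N * l ≠ 0 := (mul_pos hN hl).ne'
      induction i using Fin.addCases with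
      | left k =>
        rw [hfc]
        apply mul_left_cancel₀ hNl
        fin_cases k <;> simp
        · linear_combination (-h0 - h1 + h2 + h3) / 8 +
            l * w (Fin.castAdd m 1) * w (Fin.castAdd m 2) * hκ
        · linear_combination (-h0 + h1 - h2 + h3) / 8 +
            l * w (Fin.castAdd m 2) * w (Fin.castAdd m 0) * hκ
        · linear_combination (-h0 + h1 + h2 - h3) / 8 +
            l * w (Fin.castAdd m 0) * w (Fin.castAdd m 1) * hκ
      | right j => rw [hpj, footPoint_natAdd]
    refine ⟨hpw', ?_⟩
    rw [← hpw'] at hfn hfi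
    rw [hpw] at hfi
    obtain ⟨q, hq⟩ : ∃ q, q = w (Fin.castAdd m 0) ^ 2 + w (Fin.castAdd m 1) ^ 2 +
      w (Fin.castAdd m 2) ^ 2 := ⟨_, rfl⟩
    have hsum : N * (‖p‖ ^ 2 + 3 * l ^ 2 - 1) = l ^ 2 * q := by
      linear_combination (h0 + h1 + h2 + h3) / 4 - l ^ 2 * hq
    have hl0 : l ^ 2 ≠ 0 := by positivity
    have hj (j : Fin m) : a ^ 2 * w (Fin.natAdd 3 j) ^ 2 = N * a ^ 2 - 3 * N + q := by
      apply mul_left_cancel₀ hl0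
      linear_combination hsum - (hp j + hm j) / 2
    have hq5 : q = 5 := by
      rw [← hq] at hw'
      rcases Nat.eq_zero_or_pos m with rfl | hmpos
      · simp at hw' hN_def
        linarith
      · have hsj := Finset.sum_congr (rfl : (Finset.univ : Finset (Fin m)) = _) fun j _ => hj j
        rw [← Finset.mul_sum, Finset.sum_const, Finset.card_univ, Fintype.card_fin,
          nsmul_eq_mul] at hsj
        have ha2' := ha2 ⟨0, hmpos⟩
        have hm2 : ((m : ℝ) + 1) * (m + 2) ≠ 0 := by positivity
        apply mul_left_cancel₀ hm2
        linear_combination (-m : ℝ) * hsj - m * a ^ 2 * hw' + (N - q - m * N) * ha2'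
          + (m + 2) * hN_def
    have hsp := hsum
    rw [hq5, hfn] at hsp
    refine ⟨?_, hq5 ▸ hq.symm, ?_, fun j => ?_⟩
    · simpa [hκ0] using hfi.symm
    · apply mul_left_cancel₀ hl0
      rw [← hκ] at hsp hl2 ⊢
      linear_combination N * hsp - hl2
    · have haj := ha j
      have ha0 : a ^ 2 ≠ 0 := by positivity
      apply mul_left_cancel₀ ha0
      rw [hj, hq5]
      linear_combination 5 * ha2 j + (a ^ 2 - 3) * hN_def
  · rintro ⟨rfl, h⟩
    have hsq := h.sum_sq
    have key : N * (κ ^ 2 * 4) + 3 * l ^ 2 * N - N = 5 * l ^ 2 := by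
      apply mul_left_cancel₀ hN.ne'
      linear_combination hl2 + 4 * (N * κ + l) * hκ
    rw [h.sum_prod_sq] at hfn
    simp only [hfn, hfc, footPoint_natAdd, h.sq_eq_five]
    simp only [mul_zero, sub_zero, add_zero, zero_add, Fin.isValue, Fin.reduceAdd]
    refine ⟨⟨?_, ?_, ?_, ?_⟩, fun j => ?_, fun j => ?_⟩
    · linear_combination key - l ^ 2 * hsq + 2 * l * (w (Fin.castAdd m 1) * w (Fin.castAdd m 2) +
        w (Fin.castAdd m 2) * w (Fin.castAdd m 0) + w (Fin.castAdd m 0) * w (Fin.castAdd m 1)) * hκ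
    · linear_combination key - l ^ 2 * hsq + 2 * l * (w (Fin.castAdd m 1) * w (Fin.castAdd m 2) -
        w (Fin.castAdd m 2) * w (Fin.castAdd m 0) - w (Fin.castAdd m 0) * w (Fin.castAdd m 1)) * hκ
    · linear_combination key - l ^ 2 * hsq + 2 * l * (-w (Fin.castAdd m 1) * w (Fin.castAdd m 2) +
        w (Fin.castAdd m 2) * w (Fin.castAdd m 0) - w (Fin.castAdd m 0) * w (Fin.castAdd m 1)) * hκ
    · linear_combination key - l ^ 2 * hsq + 2 * l * (-w (Fin.castAdd m 1) * w (Fin.castAdd m 2) -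
        w (Fin.castAdd m 2) * w (Fin.castAdd m 0) + w (Fin.castAdd m 0) * w (Fin.castAdd m 1)) * hκ
    all_goals linear_combination key + 5 * l ^ 2 * ha2 j + l ^ 2 * (a ^ 2 - 3) * hN_def

/-- Representatives, up to sign, of the directions of the common tangents. -/
noncomputable def tangentDirection (t : (Fin 3 × Bool × Bool) × (Fin m → Bool)) :
    EuclideanSpace ℝ (Fin (3 + m)) :=
  WithLp.toLp 2 (Fin.append (fun k => (baseTriple t.1 k : ℝ)) fun j => if t.2 j then √5 else -√5)

theorem tangentDirection_castAdd (t : (Fin 3 × Bool × Bool) × (Fin m → Bool)) (k : Fin 3) :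
    tangentDirection t (Fin.castAdd m k) = baseTriple t.1 k := by
  simp only [tangentDirection, Fin.append_left]

theorem tangentDirection_natAdd (t : (Fin 3 × Bool × Bool) × (Fin m → Bool)) (j : Fin m) :
    tangentDirection t (Fin.natAdd 3 j) = if t.2 j then √5 else -√5 := by
  simp only [tangentDirection, Fin.append_right]

theorem isTangentDirection_tangentDirection (t : (Fin 3 × Bool × Bool) × (Fin m → Bool)) :
    IsTangentDirection (tangentDirection t) := by
  constructor <;> simp only [tangentDirection_castAdd, tangentDirection_natAdd]
  · exact_mod_cast baseTriple_prod t.1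
  · exact_mod_cast baseTriple_sum_sq t.1
  · exact_mod_cast baseTriple_sum_prod_sq t.1
  · intro j
    split_ifs <;> simp

theorem tangentDirection_injective : Function.Injective (tangentDirection (m := m)) := by
  rintro ⟨s, ε⟩ ⟨t, δ⟩ h
  have hs : s = t := baseTriple_injective <| funext fun k => by
    simpa [tangentDirection_castAdd] using congrArg (fun w => w (Fin.castAdd m k)) h
  have h5 : √5 ≠ -√5 := by
    have : (0 : ℝ) < √5 := by positivity
    linarith
  have hε : ε = δ := funext fun j => by
    have hj := congrArg (fun w => w (Fin.natAdd 3 j)) h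
    simp only [tangentDirection_natAdd] at hj
    cases hε : ε j <;> cases hδ : δ j <;>
      simp only [hε, hδ, if_true, if_false, Bool.false_eq_true] at hj ⊢
    exacts [(h5 hj.symm).elim, (h5 hj).elim]
  rw [hs, hε]

theorem tangentDirection_ne_neg (s t : (Fin 3 × Bool × Bool) × (Fin m → Bool)) :
    tangentDirection s ≠ -tangentDirection t := by
  intro h
  obtain ⟨k, hk⟩ := baseTriple_ne_neg s.1 t.1
  have := congrArg (fun w => w (Fin.castAdd m k)) h
  simp only [PiLp.neg_apply, tangentDirection_castAdd] at this
  exact hk (by exact_mod_cast this)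

theorem IsTangentDirection.neg {w : EuclideanSpace ℝ (Fin (3 + m))} (hw : IsTangentDirection w) :
    IsTangentDirection (-w) := by
  obtain ⟨h1, h2, h3, h4⟩ := hw
  constructor <;> simp only [PiLp.neg_apply, neg_mul_neg, neg_sq, h2, h3, h4, implies_true]
  rw [mul_neg, h1, neg_zero]

theorem IsTangentDirection.eq_tangentDirection {w : EuclideanSpace ℝ (Fin (3 + m))}
    (hw : IsTangentDirection w) {t : Fin 3 × Bool × Bool}
    (ht : ∀ k, w (Fin.castAdd m k) = baseTriple t k) :
    ∃ s, w = tangentDirection s := by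
  refine ⟨(t, fun j => decide (0 < w (Fin.natAdd 3 j))), ?_⟩
  ext i
  induction i using Fin.addCases with
  | left k => rw [ht, tangentDirection_castAdd]
  | right j =>
    have h5 : (0 : ℝ) < √5 := by positivity
    have hj := hw.sq_eq_five j
    rw [← Real.sq_sqrt (show (0 : ℝ) ≤ 5 by norm_num), sq_eq_sq_iff_eq_or_eq_neg] at hj
    rw [tangentDirection_natAdd]
    rcases hj with hj | hj <;> simp [hj]

theorem IsTangentDirection.exists_eq {w : EuclideanSpace ℝ (Fin (3 + m))}
    (hw : IsTangentDirection w) :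
    ∃ t, w = tangentDirection t ∨ w = -tangentDirection t := by
  obtain ⟨t, ht | ht⟩ := exists_baseTriple (x := fun k => w (Fin.castAdd m k))
    hw.prod_eq_zero hw.sum_sq hw.sum_prod_sq
  · obtain ⟨s, hs⟩ := hw.eq_tangentDirection ht
    exact ⟨s, Or.inl hs⟩
  · obtain ⟨s, hs⟩ := hw.neg.eq_tangentDirection (t := t) fun k => by
      rw [PiLp.neg_apply, ht, neg_neg]
    exact ⟨s, Or.inr (neg_eq_iff_eq_neg.1 hs)⟩

/-- The common tangents of the spheres. -/
noncomputable def commonTangent (t : (Fin 3 × Bool × Bool) × (Fin m → Bool)) :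
    AffineSubspace ℝ (EuclideanSpace ℝ (Fin (3 + m))) :=
  lineThrough (footPoint (tangentDirection t)) (tangentDirection t)

theorem IsTangentDirection.ne_zero {w : EuclideanSpace ℝ (Fin (3 + m))}
    (hw : IsTangentDirection w) : w ≠ 0 := by
  rintro rfl
  simpa using hw.sum_sq

theorem commonTangent_injective : Function.Injective (commonTangent (m := m)) := by
  intro s t h
  have hs := isTangentDirection_tangentDirection s
  have ht := isTangentDirection_tangentDirection t
  have hn : ‖tangentDirection s‖ = ‖tangentDirection t‖ := by
    rw [← sq_eq_sq₀ (norm_nonneg _) (norm_nonneg _), hs.norm_sq, ht.norm_sq]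
  rcases eq_or_eq_neg_of_lineThrough_eq hs.ne_zero hn h with h | h
  · exact (tangentDirection_injective h).symm
  · exact (tangentDirection_ne_neg _ _ h).elim

theorem setOf_tangent_eq_range_commonTangent :
    {ℓ : AffineSubspace ℝ (EuclideanSpace ℝ (Fin (3 + m))) | Module.finrank ℝ ℓ.direction = 1 ∧
      ∀ i, infDist (sphereCenter m i) (ℓ : Set (EuclideanSpace ℝ (Fin (3 + m)))) = 1} =
      Set.range commonTangent := by
  ext ℓ
  constructor
  · rintro ⟨hℓ, h⟩
    obtain ⟨p, w, hw, hpw, rfl⟩ :=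
      exists_eq_lineThrough hℓ (r := √(5 * (m + 1))) (by positivity)
    have hw2 : ‖w‖ ^ 2 = 5 * (m + 1) := by rw [hw, Real.sq_sqrt (by positivity)]
    obtain ⟨rfl, hwt⟩ := (infDist_sphereCenter_eq_one_iff hw2 hpw).1 h
    obtain ⟨t, rfl | rfl⟩ := hwt.exists_eq
    · exact ⟨t, rfl⟩
    · refine ⟨t, ?_⟩
      rw [commonTangent, footPoint_neg, lineThrough, lineThrough, ← Set.neg_singleton,
        Submodule.span_neg]
  · rintro ⟨t, rfl⟩
    have ht := isTangentDirection_tangentDirection t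
    refine ⟨finrank_direction_lineThrough _ ht.ne_zero, ?_⟩
    refine (infDist_sphereCenter_eq_one_iff ht.norm_sq ?_).2 ⟨rfl, ht⟩
    rw [inner_footPoint, ht.prod_eq_zero, mul_zero, mul_zero]

end Coordinates

/-- for every `n ≥ 3` there is a configuration of `2n−2` unit spheres in `ℝⁿ`
with exactly `3·2^{n−1}` real common tangent lines. -/
theorem exists_config_max_real_tangents (n : ℕ) (hn : 3 ≤ n) :
    ∃ c : Fin (2 * n - 2) → EuclideanSpace ℝ (Fin n),
      (({ℓ | Module.finrank ℝ ℓ.direction = 1 ∧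
          ∀ i, Metric.infDist (c i) (ℓ : Set (EuclideanSpace ℝ (Fin n))) = 1} :
            Set (AffineSubspace ℝ (EuclideanSpace ℝ (Fin n)))).Finite) ∧
      (({ℓ | Module.finrank ℝ ℓ.direction = 1 ∧
          ∀ i, Metric.infDist (c i) (ℓ : Set (EuclideanSpace ℝ (Fin n))) = 1} :
            Set (AffineSubspace ℝ (EuclideanSpace ℝ (Fin n)))).ncard = 3 * 2 ^ (n - 1)) := by
  obtain ⟨m, rfl⟩ := Nat.exists_eq_add_of_le hn
  have e : Fin (2 * (3 + m) - 2) ≃ Fin 4 ⊕ Fin m ⊕ Fin m :=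
    Fintype.equivOfCardEq (by simp; omega)
  refine ⟨sphereCenter m ∘ e, ?_⟩
  simp only [Function.comp_apply,
    e.forall_congr_left (p := fun i => infDist (sphereCenter m (e i)) _ = 1), e.apply_symm_apply,
    setOf_tangent_eq_range_commonTangent]
  refine ⟨Set.finite_range _, ?_⟩
  rw [Set.ncard_range_of_injective commonTangent_injective, Nat.card_eq_fintype_card]
  simp only [Fintype.card_prod, Fintype.card_fin, Fintype.card_bool, Fintype.card_fun]
  rw [show 3 + m - 1 = m + 2 by omega, pow_add]
  ring
end

section
/- There exist points c_1, c_2, c_3, c_4 ∈ ℝ³ such that the set of one-dimensional affine subspaces ℓ of ℝ³ whose Euclidean distance from c_i equals 1 for every i = 1, 2, 3, 4 has exactly 12 elements. (Four unit spheres in ℝ³ can have 12 distinct real common tangent lines.) -/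
open Module AffineSubspace

local notation "𝔼" => EuclideanSpace ℝ (Fin 3)

/-- Squared distance from a point to a line, cleared of denominators. -/
theorem infDist_mk'_span_singleton_sq {V : Type*} [NormedAddCommGroup V] [InnerProductSpace ℝ V]
    (c p v : V) :
    Metric.infDist c (mk' p (Submodule.span ℝ {v}) : Set V) ^ 2 * ‖v‖ ^ 2
      = ‖c - p‖ ^ 2 * ‖v‖ ^ 2 - inner ℝ v (c - p) ^ 2 := by
  have : (mk' p (Submodule.span ℝ {v})).direction.HasOrthogonalProjection := by
    rw [direction_mk']; infer_instance
  rw [← EuclideanGeometry.dist_orthogonalProjection_eq_infDist,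
    EuclideanGeometry.orthogonalProjection_apply_mem _ (self_mem_mk' p _)]
  rcases eq_or_ne v 0 with rfl | hv
  · simp
  have hv' : ‖v‖ ≠ 0 := norm_ne_zero_iff.2 hv
  have hproj (W : Submodule ℝ V) [W.HasOrthogonalProjection] (hW : W = Submodule.span ℝ {v}) :
      (W.orthogonalProjectionOnto (c - p) : V) = (inner ℝ v (c - p) / ‖v‖ ^ 2) • v := by
    subst hW
    exact Submodule.starProjection_singleton ℝ (v := v) (c - p)
  rw [vsub_eq_sub, hproj _ (direction_mk' p _), dist_eq_norm, vadd_eq_add, ← sub_sub, sub_right_comm, norm_sub_sq_real,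
    norm_smul, inner_smul_right, real_inner_comm, mul_pow, Real.norm_eq_abs, sq_abs]
  field_simp
  ring

/-- A vector of `ℝ³` with integer coordinates. -/
noncomputable def intVec (d : ℤ × ℤ × ℤ) : 𝔼 := !₂[(d.1 : ℝ), (d.2.1 : ℝ), (d.2.2 : ℝ)]

/-- The point closest to the origin on the common tangent of direction `d`. -/
noncomputable def tangentFoot (a : ℝ) (d : ℤ × ℤ × ℤ) : 𝔼 :=
  !₂[-(a / 5) * (d.2.1 * d.2.2), -(a / 5) * (d.1 * d.2.2), -(a / 5) * (d.1 * d.2.1)]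

/-- The common tangent of direction `d`. -/
noncomputable def tangentLine (a : ℝ) (d : ℤ × ℤ × ℤ) : AffineSubspace ℝ 𝔼 :=
  mk' (tangentFoot a d) (Submodule.span ℝ {intVec d})

/-- Directions of the twelve common tangents, one representative for each line. -/
def tangentDirections : Finset (ℤ × ℤ × ℤ) :=
  {(0, 1, 2), (0, 1, -2), (0, 2, 1), (0, 2, -1), (1, 0, 2), (1, 0, -2), (2, 0, 1), (2, 0, -1),
    (1, 2, 0), (1, -2, 0), (2, 1, 0), (2, -1, 0)}

/-- The vertices of a regular tetrahedron inscribed in the cube `[-a, a]³`. -/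
noncomputable def tetrahedronVertex (a : ℝ) : Fin 4 → 𝔼 :=
  ![!₂[a, a, a], !₂[a, -a, -a], !₂[-a, a, -a], !₂[-a, -a, a]]

theorem card_tangentDirections : tangentDirections.card = 12 := by decide

theorem neg_notMem_tangentDirections : ∀ d ∈ tangentDirections, -d ∉ tangentDirections := by
  decide

theorem tangentDirections_spec : ∀ d ∈ tangentDirections,
    d.1 ^ 2 + d.2.1 ^ 2 + d.2.2 ^ 2 = 5 ∧ d.1 * d.2.1 * d.2.2 = 0 ∧
      (d.2.1 * d.2.2) ^ 2 + (d.1 * d.2.2) ^ 2 + (d.1 * d.2.1) ^ 2 = 4 := by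
  decide

theorem norm_sq_intVec (d : ℤ × ℤ × ℤ) :
    ‖intVec d‖ ^ 2 = (d.1 : ℝ) ^ 2 + (d.2.1 : ℝ) ^ 2 + (d.2.2 : ℝ) ^ 2 := by
  simp [intVec, EuclideanSpace.norm_sq_eq, Fin.sum_univ_three]

theorem norm_sq_intVec_of_mem {d : ℤ × ℤ × ℤ} (hd : d ∈ tangentDirections) :
    ‖intVec d‖ ^ 2 = 5 := by
  rw [norm_sq_intVec]
  exact_mod_cast (tangentDirections_spec d hd).1

theorem intVec_ne_zero_of_mem {d : ℤ × ℤ × ℤ} (hd : d ∈ tangentDirections) : intVec d ≠ 0 := by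
  intro h
  have := norm_sq_intVec_of_mem hd
  simp [h] at this

theorem intVec_injective : Function.Injective intVec := by
  rintro ⟨x, y, z⟩ ⟨x', y', z'⟩ h
  have h0 := congrArg (· 0) h
  have h1 := congrArg (· 1) h
  have h2 := congrArg (· 2) h
  simp [intVec] at h0 h1 h2
  simp [h0, h1, h2]

theorem intVec_neg (d : ℤ × ℤ × ℤ) : intVec (-d) = -intVec d := by
  ext i
  fin_cases i <;> simp [intVec]

theorem injOn_tangentLine (a : ℝ) : Set.InjOn (tangentLine a) tangentDirections := by
  intro d hd d' hd' h
  rw [Finset.mem_coe] at hd hd'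
  have hdir := congrArg AffineSubspace.direction h
  simp only [tangentLine, direction_mk'] at hdir
  obtain ⟨k, hk⟩ := Submodule.mem_span_singleton.1
    (hdir ▸ Submodule.mem_span_singleton_self (intVec d))
  have hn := norm_sq_intVec_of_mem hd
  rw [← hk, norm_smul, mul_pow, norm_sq_intVec_of_mem hd', Real.norm_eq_abs, sq_abs] at hn
  have hk1 : k ^ 2 = 1 := by linarith
  rcases (sq_eq_sq_iff_eq_or_eq_neg.1 (hk1.trans (one_pow 2).symm)) with rfl | rfl
  · exact (intVec_injective (by simpa using hk)).symm
  · rw [neg_one_smul, ← intVec_neg] at hk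
    have := intVec_injective hk
    exact absurd (this ▸ hd) (neg_notMem_tangentDirections d' hd')

theorem finrank_direction_tangentLine (a : ℝ) {d : ℤ × ℤ × ℤ} (hd : d ∈ tangentDirections) :
    finrank ℝ (tangentLine a d).direction = 1 := by
  rw [tangentLine, direction_mk', finrank_span_singleton (intVec_ne_zero_of_mem hd)]

theorem infDist_tangentLine {a : ℝ} (ha : a ^ 2 = 25 / 54) {d : ℤ × ℤ × ℤ}
    (hd : d ∈ tangentDirections) (i : Fin 4) :
    Metric.infDist (tetrahedronVertex a i) (tangentLine a d : Set 𝔼) = 1 := by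
  have h := infDist_mk'_span_singleton_sq (tetrahedronVertex a i) (tangentFoot a d) (intVec d)
  obtain ⟨h5, h0, h4⟩ := tangentDirections_spec d hd
  obtain ⟨x, y, z⟩ := d
  have h5 : (x : ℝ) ^ 2 + y ^ 2 + z ^ 2 = 5 := by exact_mod_cast h5
  have h0 : (x : ℝ) * y * z = 0 := by exact_mod_cast h0
  have h4 : ((y : ℝ) * z) ^ 2 + (x * z) ^ 2 + (x * y) ^ 2 = 4 := by exact_mod_cast h4
  rw [norm_sq_intVec_of_mem hd] at h
  refine (sq_eq_sq₀ Metric.infDist_nonneg zero_le_one).1 ?_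
  rw [tangentLine]
  suffices H : ‖tetrahedronVertex a i - tangentFoot a (x, y, z)‖ ^ 2 * 5
      - inner ℝ (intVec (x, y, z)) (tetrahedronVertex a i - tangentFoot a (x, y, z)) ^ 2 = 5 by
    linarith
  have key (r s t : ℝ) (hr : r ^ 2 = 1) (hs : s ^ 2 = 1) (hrs : t = r * s) :
      ‖!₂[a * r, a * s, a * t] - tangentFoot a (x, y, z)‖ ^ 2 * 5
        - inner ℝ (intVec (x, y, z)) (!₂[a * r, a * s, a * t] - tangentFoot a (x, y, z)) ^ 2
        = 5 := by
    simp only [EuclideanSpace.norm_sq_eq, Fin.sum_univ_three, PiLp.inner_apply, tangentFoot,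
      intVec, PiLp.sub_apply, Real.norm_eq_abs, sq_abs]
    simp
    have hdot : (a * r + a / 5 * (y * z)) * x + (a * s + a / 5 * (x * z)) * y
        + (a * t + a / 5 * (x * y)) * z = a * (r * x + s * y + t * z) := by
      linear_combination 3 * a / 5 * h0
    rw [hdot]
    subst hrs
    linear_combination (54 / 5 : ℝ) * ha + a ^ 2 / 5 * h4 - a ^ 2 * h5
      + a ^ 2 * (5 + 5 * s ^ 2 - x ^ 2 - z ^ 2 * s ^ 2 - 2 * s * x * z) * hr
      + a ^ 2 * (10 - y ^ 2 - z ^ 2 - 2 * r * y * z) * hs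
  fin_cases i
  · simpa [tetrahedronVertex] using key 1 1 1 (by norm_num) (by norm_num) (by norm_num)
  · simpa [tetrahedronVertex] using key 1 (-1) (-1) (by norm_num) (by norm_num) (by norm_num)
  · simpa [tetrahedronVertex] using key (-1) 1 (-1) (by norm_num) (by norm_num) (by norm_num)
  · simpa [tetrahedronVertex] using key (-1) (-1) 1 (by norm_num) (by norm_num) (by norm_num)

theorem exists_ratio_of_quartic {x y : ℝ} (h : 4 * (x ^ 2 + y ^ 2) ^ 2 = 25 * (x * y) ^ 2) :
    ∃ k : ℝ, (x = k ∧ y = 2 * k) ∨ (x = k ∧ y = -2 * k) ∨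
      (x = 2 * k ∧ y = k) ∨ (x = 2 * k ∧ y = -k) := by
  have h' : (y - 2 * x) * ((y + 2 * x) * ((x - 2 * y) * (x + 2 * y))) = 0 := by
    linear_combination -h
  rcases mul_eq_zero.1 h' with h | h
  · exact ⟨x, .inl ⟨rfl, by linarith⟩⟩
  rcases mul_eq_zero.1 h with h | h
  · exact ⟨x, .inr (.inl ⟨rfl, by linarith⟩)⟩
  rcases mul_eq_zero.1 h with h | h
  · exact ⟨y, .inr (.inr (.inl ⟨by linarith, rfl⟩))⟩
  · exact ⟨-y, .inr (.inr (.inr ⟨by linarith, by ring⟩))⟩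

theorem exists_mem_tangentDirections {x y z : ℝ} (h0 : x * y * z = 0)
    (h : 4 * (x ^ 2 + y ^ 2 + z ^ 2) ^ 2 = 25 * ((y * z) ^ 2 + (x * z) ^ 2 + (x * y) ^ 2)) :
    ∃ d ∈ tangentDirections, ∃ k : ℝ, x = k * d.1 ∧ y = k * d.2.1 ∧ z = k * d.2.2 := by
  rcases mul_eq_zero.1 h0 with h0 | rfl
  · rcases mul_eq_zero.1 h0 with rfl | rfl
    · obtain ⟨k, h | h | h | h⟩ := exists_ratio_of_quartic (x := y) (y := z)
        (by linear_combination h)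
      · exact ⟨(0, 1, 2), by decide, k, by simp [h, mul_comm]⟩
      · exact ⟨(0, 1, -2), by decide, k, by simp [h, mul_comm]⟩
      · exact ⟨(0, 2, 1), by decide, k, by simp [h, mul_comm]⟩
      · exact ⟨(0, 2, -1), by decide, k, by simp [h, mul_comm]⟩
    · obtain ⟨k, h | h | h | h⟩ := exists_ratio_of_quartic (x := x) (y := z)
        (by linear_combination h)
      · exact ⟨(1, 0, 2), by decide, k, by simp [h, mul_comm]⟩
      · exact ⟨(1, 0, -2), by decide, k, by simp [h, mul_comm]⟩
      · exact ⟨(2, 0, 1), by decide, k, by simp [h, mul_comm]⟩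
      · exact ⟨(2, 0, -1), by decide, k, by simp [h, mul_comm]⟩
  · obtain ⟨k, h | h | h | h⟩ := exists_ratio_of_quartic (x := x) (y := y)
      (by linear_combination h)
    · exact ⟨(1, 2, 0), by decide, k, by simp [h, mul_comm]⟩
    · exact ⟨(1, -2, 0), by decide, k, by simp [h, mul_comm]⟩
    · exact ⟨(2, 1, 0), by decide, k, by simp [h, mul_comm]⟩
    · exact ⟨(2, -1, 0), by decide, k, by simp [h, mul_comm]⟩

/-- Every line has a nonzero direction vector and a point orthogonal to it. -/
theorem exists_eq_mk'_span_singleton_orthogonal {V : Type*} [NormedAddCommGroup V]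
    [InnerProductSpace ℝ V] {ℓ : AffineSubspace ℝ V} (h : finrank ℝ ℓ.direction = 1) :
    ∃ v p : V, v ≠ 0 ∧ inner ℝ v p = 0 ∧ ℓ = mk' p (Submodule.span ℝ {v}) := by
  have hne : (ℓ : Set V).Nonempty := by
    rw [nonempty_iff_ne_bot]
    rintro rfl
    rw [direction_bot, finrank_bot] at h
    exact zero_ne_one h
  obtain ⟨q, hq⟩ := hne
  obtain ⟨⟨v, hv⟩, hv0, hspan⟩ := finrank_eq_one_iff'.1 h
  have hv0' : v ≠ 0 := fun h => hv0 (Subtype.ext h)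
  have hdir : ℓ.direction = Submodule.span ℝ {v} := by
    refine le_antisymm (fun w hw => ?_) ((Submodule.span_singleton_le_iff_mem _ _).2 hv)
    obtain ⟨k, hk⟩ := hspan ⟨w, hw⟩
    exact Submodule.mem_span_singleton.2 ⟨k, congrArg Subtype.val hk⟩
  refine ⟨v, -(inner ℝ v q / ‖v‖ ^ 2) • v +ᵥ q, hv0', ?_, ?_⟩
  · have : ‖v‖ ≠ 0 := norm_ne_zero_iff.2 hv0'
    rw [vadd_eq_add, inner_add_right, inner_smul_right, real_inner_self_eq_norm_sq]
    field_simp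
    ring
  · rw [← hdir, mk'_eq (vadd_mem_of_mem_direction (ℓ.direction.smul_mem _ hv) hq)]

theorem eq_tangentLine {a : ℝ} (ha : a ^ 2 = 25 / 54) {ℓ : AffineSubspace ℝ 𝔼}
    (hℓ : finrank ℝ ℓ.direction = 1)
    (hdist : ∀ i, Metric.infDist (tetrahedronVertex a i) (ℓ : Set 𝔼) = 1) :
    ∃ d ∈ tangentDirections, tangentLine a d = ℓ := by
  obtain ⟨v, p, hv, hvp, rfl⟩ := exists_eq_mk'_span_singleton_orthogonal hℓ
  have ha0 : a ≠ 0 := by rintro rfl; norm_num at ha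
  have E (i : Fin 4) := infDist_mk'_span_singleton_sq (tetrahedronVertex a i) p v
  simp only [hdist, EuclideanSpace.norm_sq_eq, Fin.sum_univ_three, PiLp.inner_apply,
    PiLp.sub_apply, Real.norm_eq_abs, sq_abs, RCLike.inner_apply, conj_trivial] at E hvp
  have E0 := E 0
  have E1 := E 1
  have E2 := E 2
  have E3 := E 3
  simp [tetrahedronVertex] at E0 E1 E2 E3
  have hN : v 0 ^ 2 + v 1 ^ 2 + v 2 ^ 2 ≠ 0 := by
    intro h
    refine hv (norm_eq_zero.1 (pow_eq_zero_iff two_ne_zero |>.1 ?_))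
    simpa [EuclideanSpace.norm_sq_eq, Fin.sum_univ_three] using h
  generalize hx : v 0 = x at *
  generalize hy : v 1 = y at *
  generalize hz : v 2 = z at *
  have P0 : (x ^ 2 + y ^ 2 + z ^ 2) * p 0 = -a * (y * z) := by
    refine mul_left_cancel₀ ha0 ?_
    linear_combination (E0 + E1 - E2 - E3) / 8 + a * x * hvp
  have P1 : (x ^ 2 + y ^ 2 + z ^ 2) * p 1 = -a * (x * z) := by
    refine mul_left_cancel₀ ha0 ?_
    linear_combination (E0 - E1 + E2 - E3) / 8 + a * y * hvp
  have P2 : (x ^ 2 + y ^ 2 + z ^ 2) * p 2 = -a * (x * y) := by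
    refine mul_left_cancel₀ ha0 ?_
    linear_combination (E0 - E1 - E2 + E3) / 8 + a * z * hvp
  have hC : (x ^ 2 + y ^ 2 + z ^ 2) * (2 * a ^ 2 - 1 + p 0 ^ 2 + p 1 ^ 2 + p 2 ^ 2) = 0 := by
    linear_combination -(E0 + E1 + E2 + E3) / 4 + (p 0 * x + p 1 * y + p 2 * z) * hvp
  have hC' := (mul_eq_zero.1 hC).resolve_left hN
  have h0 : x * y * z = 0 := by
    refine mul_left_cancel₀ ha0 ?_
    linear_combination (x * P0 + y * P1 + z * P2 - (x ^ 2 + y ^ 2 + z ^ 2) * hvp) / 3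
  have hq : 4 * (x ^ 2 + y ^ 2 + z ^ 2) ^ 2
      = 25 * ((y * z) ^ 2 + (x * z) ^ 2 + (x * y) ^ 2) := by
    have Q0 := congrArg (· ^ 2) P0
    have Q1 := congrArg (· ^ 2) P1
    have Q2 := congrArg (· ^ 2) P2
    simp only [mul_pow, neg_sq, ha] at Q0 Q1 Q2
    linear_combination -54 * (x ^ 2 + y ^ 2 + z ^ 2) ^ 2 * hC' + 54 * (Q0 + Q1 + Q2)
      + 108 * (x ^ 2 + y ^ 2 + z ^ 2) ^ 2 * ha
  obtain ⟨d, hd, k, hkx, hky, hkz⟩ := exists_mem_tangentDirections h0 hq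
  have hd5 : (d.1 : ℝ) ^ 2 + d.2.1 ^ 2 + d.2.2 ^ 2 = 5 := by
    exact_mod_cast (tangentDirections_spec d hd).1
  have hN5 : x ^ 2 + y ^ 2 + z ^ 2 = k ^ 2 * 5 := by
    rw [hkx, hky, hkz]
    linear_combination k ^ 2 * hd5
  have hk : k ≠ 0 := by rintro rfl; simp [hN5] at hN
  have hvd : v = k • intVec d := by
    ext i
    fin_cases i <;> simp [intVec, *]
  have hpd : p = tangentFoot a d := by
    rw [hN5, hky, hkz] at P0
    rw [hN5, hkx, hkz] at P1
    rw [hN5, hkx, hky] at P2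
    have hk2 : k ^ 2 * 5 ≠ 0 := by positivity
    ext i
    fin_cases i
    · exact mul_left_cancel₀ hk2 (by simp [tangentFoot]; linear_combination P0)
    · exact mul_left_cancel₀ hk2 (by simp [tangentFoot]; linear_combination P1)
    · exact mul_left_cancel₀ hk2 (by simp [tangentFoot]; linear_combination P2)
  refine ⟨d, hd, ?_⟩
  rw [tangentLine, hvd, hpd, Submodule.span_singleton_smul_eq hk.isUnit]

/-- there exist four unit spheres in `ℝ³` with exactly `12` distinct real
common tangent lines. -/
theorem exists_four_unit_spheres_twelve_real_tangents :
    ∃ c : Fin 4 → EuclideanSpace ℝ (Fin 3),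
      (({ℓ | Module.finrank ℝ ℓ.direction = 1 ∧
          ∀ i, Metric.infDist (c i) (ℓ : Set (EuclideanSpace ℝ (Fin 3))) = 1} :
            Set (AffineSubspace ℝ (EuclideanSpace ℝ (Fin 3)))).Finite) ∧
      (({ℓ | Module.finrank ℝ ℓ.direction = 1 ∧
          ∀ i, Metric.infDist (c i) (ℓ : Set (EuclideanSpace ℝ (Fin 3))) = 1} :
            Set (AffineSubspace ℝ (EuclideanSpace ℝ (Fin 3)))).ncard = 12) := by
  have ha : √(25 / 54 : ℝ) ^ 2 = 25 / 54 := Real.sq_sqrt (by norm_num)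
  refine ⟨tetrahedronVertex √(25 / 54), ?_⟩
  have hset : {ℓ : AffineSubspace ℝ 𝔼 | finrank ℝ ℓ.direction = 1 ∧
      ∀ i, Metric.infDist (tetrahedronVertex √(25 / 54) i) (ℓ : Set 𝔼) = 1}
      = tangentLine √(25 / 54) '' tangentDirections := by
    ext ℓ
    constructor
    · rintro ⟨h, hdist⟩
      exact eq_tangentLine ha h hdist
    · rintro ⟨d, hd, rfl⟩
      exact ⟨finrank_direction_tangentLine _ hd, infDist_tangentLine ha hd⟩
  rw [hset]
  refine ⟨tangentDirections.finite_toSet.image _, ?_⟩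
  rw [(injOn_tangentLine _).ncard_image, Set.ncard_coe_finset,
    card_tangentDirections]
end

section
/- For every n ≥ 4, the polynomial ∑_{1≤i≠j≤n} X_i² X_j + 2·∑_{1≤i<j<k≤n} X_i X_j X_k in the multivariate polynomial ring ℂ[X_1, …, X_n] is irreducible. -/
open MvPolynomial

/-- Reversal reflects irreducibility for polynomials with nonzero constant term. -/
theorem Polynomial.irreducible_of_irreducible_reverse {R : Type*} [CommRing R] [IsDomain R]
    {f : Polynomial R} (h0 : f.coeff 0 ≠ 0) (hf : Irreducible f.reverse) : Irreducible f := by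
  have key : ∀ g : Polynomial R, g.coeff 0 ≠ 0 → IsUnit g.reverse → IsUnit g := by
    intro g hg hu
    have hd := g.natDegree_eq_reverse_natDegree_add_natTrailingDegree
    rw [Polynomial.natDegree_eq_zero_of_isUnit hu,
      Polynomial.natTrailingDegree_eq_zero_of_constantCoeff_ne_zero hg] at hd
    rw [Polynomial.eq_C_of_natDegree_eq_zero hd] at hu ⊢
    rwa [Polynomial.reverse_C] at hu
  refine ⟨fun hu => hf.not_isUnit ?_, fun a b hab => ?_⟩
  · obtain ⟨r, hr, rfl⟩ := Polynomial.isUnit_iff.mp hu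
    rwa [Polynomial.reverse_C]
  · rw [hab, Polynomial.mul_coeff_zero] at h0
    have hr : f.reverse = a.reverse * b.reverse := by
      rw [hab, Polynomial.reverse_mul_of_domain]
    exact (hf.isUnit_or_isUnit hr).imp (key a (left_ne_zero_of_mul h0))
      (key b (right_ne_zero_of_mul h0))

/-- Eisenstein's criterion for a quadratic, with the prime `a` as leading coefficient. -/
theorem Polynomial.irreducible_quadratic_of_prime {R : Type*} [CommRing R] [IsDomain R]
    {a b d : R} (ha : Prime a) (hb : a ∣ b) (hd : ¬ a ∣ d) :
    Irreducible (C a * X ^ 2 + C b * X + C d : Polynomial R) := by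
  have hd0 : d ≠ 0 := fun h => hd (h ▸ dvd_zero a)
  apply irreducible_of_irreducible_reverse
  · simpa using hd0
  have hrev : (C a * X ^ 2 + C b * X + C d : Polynomial R).reverse
      = C d * X ^ 2 + C b * X + C a := by
    ext n
    rw [coeff_reverse, natDegree_quadratic ha.ne_zero, ← revAtFun_eq]
    rcases n with _ | _ | _ | n <;> simp [revAtFun, coeff_X, coeff_C]
  rw [hrev]
  have hdeg : (C d * X ^ 2 + C b * X + C a : Polynomial R).degree = 2 := degree_quadratic hd0
  apply irreducible_of_eisenstein_criterion
    ((Ideal.span_singleton_prime ha.ne_zero).mpr ha)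
  · rwa [leadingCoeff_quadratic hd0, Ideal.mem_span_singleton]
  · intro n hn
    rw [hdeg] at hn
    have hn' : n < 2 := by exact_mod_cast hn
    rw [Ideal.mem_span_singleton]
    interval_cases n
    · simp
    · simpa [coeff_C] using hb
  · rw [hdeg]; norm_num
  · rw [Ideal.span_singleton_pow, Ideal.mem_span_singleton]
    simp only [coeff_add, mul_coeff_zero, coeff_C_zero, coeff_X_zero, coeff_X_pow, mul_zero]
    rintro ⟨c, hc⟩
    refine ha.not_isUnit (IsUnit.of_mul_eq_one c (mul_left_cancel₀ ha.ne_zero ?_))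
    simp at hc
    linear_combination -hc
  · intro r hr
    rw [C_dvd_iff_dvd_coeff] at hr
    have hra : r ∣ a := by simpa using hr 0
    have hrd : r ∣ d := by simpa [coeff_C] using hr 2
    obtain ⟨s, rfl⟩ := hra
    refine (ha.irreducible.isUnit_or_isUnit rfl).resolve_right fun hs => hd ?_
    exact (hs.mul_right_dvd).mpr hrd

namespace MvPolynomial

/-- The linear form `∑ i, X i` is prime as soon as there are two variables. -/
theorem prime_psum_one {σ K : Type*} [Fintype σ] [Nontrivial σ] [Field K] :
    Prime (psum σ K 1) := by
  rw [← irreducible_iff_prime]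
  have h := irreducible_sumSMulX (n := σ) (R := K) (Finsupp.equivFunOnFinite.symm fun _ => 1)
    (by simp [Function.support])
    (fun r hr => by
      obtain ⟨i⟩ : Nonempty σ := inferInstance
      exact isUnit_of_dvd_one (by simpa using hr i))
  simpa [sumSMulX, Finsupp.linearCombination_apply, Finsupp.sum_fintype, psum] using h

theorem not_psum_one_dvd_psum_three (m : ℕ) :
    ¬ psum (Fin (m + 3)) ℂ 1 ∣ psum (Fin (m + 3)) ℂ 3 := by
  rintro ⟨q, hq⟩
  have h := congrArg (eval fun i =>
    if i.val = 0 then 1 else if i.val = 1 then 1 else if i.val = 2 then -2 else 0) hq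
  simp only [psum, map_sum, map_mul, map_pow, eval_X] at h
  simp only [Fin.sum_univ_succ, Fin.val_succ, Fin.val_zero] at h
  norm_num [show ∀ k : ℕ, k + 1 + 1 + 1 ≠ 2 by omega] at h

/-- Three times the cubic is `(∑ i, X i) ^ 3 - ∑ i, X i ^ 3`. -/
theorem three_mul_cubic_eq {σ R : Type*} [Fintype σ] [DecidableEq σ] [CommRing R] :
    3 * ((∑ i : σ, ∑ j ∈ Finset.univ.filter (fun j => j ≠ i),
          (X i : MvPolynomial σ R) ^ 2 * X j) +
        2 * ∑ s ∈ Finset.powersetCard 3 (Finset.univ : Finset σ),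
          ∏ i ∈ s, (X i : MvPolynomial σ R)) = psum σ R 1 ^ 3 - psum σ R 3 := by
  have h1 : (∑ i : σ, ∑ j ∈ Finset.univ.filter (fun j => j ≠ i),
      (X i : MvPolynomial σ R) ^ 2 * X j) = psum σ R 2 * psum σ R 1 - psum σ R 3 := by
    simp only [psum, pow_one, Finset.sum_mul_sum, ← Finset.sum_sub_distrib]
    refine Finset.sum_congr rfl fun i _ => ?_
    rw [Finset.filter_ne', ← Finset.add_sum_erase _ _ (Finset.mem_univ i)]
    ring
  have e1 : esymm σ R 1 = psum σ R 1 := by rw [esymm_one, psum_one]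
  have a2 : Finset.HasAntidiagonal.antidiagonal 1 = {(0, 1), (1, 0)} := rfl
  have e2 := mul_esymm_eq_sum σ R 2
  have e3 := mul_esymm_eq_sum σ R 3
  simp [Finset.sum_filter, Finset.Nat.antidiagonal_succ, a2, esymm_zero, -esymm_one,
    -psum_one] at e2 e3
  rw [h1]
  change 3 * (_ + 2 * esymm σ R 3) = _
  rw [e1] at e2 e3
  linear_combination 2 * e3 + psum σ R 1 * e2

end MvPolynomial

/-- for `n ≥ 4` the cubic `∑_{i≠j} Xᵢ²Xⱼ + 2∑_{i<j<k} XᵢXⱼXₖ` is irreducible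
in `ℂ[X₁,…,Xₙ]`. -/
theorem cubic_irreducible (n : ℕ) (hn : 4 ≤ n) :
    Irreducible
      ((∑ i : Fin n, ∑ j ∈ Finset.univ.filter (fun j => j ≠ i),
          (X i : MvPolynomial (Fin n) ℂ) ^ 2 * X j) +
        2 * ∑ s ∈ Finset.powersetCard 3 (Finset.univ : Finset (Fin n)),
          ∏ i ∈ s, (X i : MvPolynomial (Fin n) ℂ)) := by
  obtain ⟨m, rfl⟩ := Nat.exists_eq_add_of_le' hn
  have h3 := three_mul_cubic_eq (σ := Fin (m + 4)) (R := ℂ)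
  set f := (∑ i : Fin (m + 4), ∑ j ∈ Finset.univ.filter (fun j => j ≠ i),
      (X i : MvPolynomial (Fin (m + 4)) ℂ) ^ 2 * X j) +
    2 * ∑ s ∈ Finset.powersetCard 3 (Finset.univ : Finset (Fin (m + 4))),
      ∏ i ∈ s, (X i : MvPolynomial (Fin (m + 4)) ℂ)
  have hpsum (k : ℕ) : finSuccEquiv ℂ (m + 3) (psum (Fin (m + 4)) ℂ k)
      = Polynomial.X ^ k + Polynomial.C (psum (Fin (m + 3)) ℂ k) := by
    simp [psum, Fin.sum_univ_succ (n := m + 3), finSuccEquiv_X_zero, finSuccEquiv_X_succ]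
  set a := psum (Fin (m + 3)) ℂ 1 with ha
  set d : MvPolynomial (Fin (m + 3)) ℂ :=
    C (1 / 3) * (a ^ 3 - psum (Fin (m + 3)) ℂ 3) with hd
  have h3d : 3 * d = a ^ 3 - psum (Fin (m + 3)) ℂ 3 := by
    rw [hd, ← mul_assoc, ← map_ofNat (C (σ := Fin (m + 3)) (R := ℂ)) 3, ← C_mul]
    norm_num
  have hf : finSuccEquiv ℂ (m + 3) f = Polynomial.C a * Polynomial.X ^ 2
      + Polynomial.C (a ^ 2) * Polynomial.X + Polynomial.C d := by
    have h := congrArg (finSuccEquiv ℂ (m + 3)) h3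
    have h3d' := congrArg Polynomial.C h3d
    simp only [map_mul, map_sub, map_pow, hpsum, map_ofNat] at h h3d' ⊢
    have : CharZero (Polynomial (MvPolynomial (Fin (m + 3)) ℂ)) :=
      charZero_of_injective_algebraMap (algebraMap ℂ _).injective
    refine mul_left_cancel₀ (by norm_num : (3 : Polynomial (MvPolynomial (Fin (m + 3)) ℂ)) ≠ 0) ?_
    rw [← ha] at h
    linear_combination h - h3d'
  rw [← MulEquiv.irreducible_iff (finSuccEquiv ℂ (m + 3)), hf]
  refine Polynomial.irreducible_quadratic_of_prime prime_psum_one (dvd_pow_self a two_ne_zero) ?_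
  intro hdvd
  refine not_psum_one_dvd_psum_three m ?_
  have h := dvd_sub (dvd_pow_self a three_ne_zero) (h3d ▸ hdvd.mul_left 3)
  rwa [sub_sub_cancel] at h
end

section
/- Let n ≥ 4, a > 0, r > 0, and consider the 2n−2 centers c_1=(1,1,1,0,…,0), c_2=(1,−1,−1,0,…,0), c_3=(−1,1,−1,0,…,0), c_4=(−1,−1,1,0,…,0), and ±a·e_j for j = 4,…,n in ℝ^n. Suppose p ∈ ℂ^n and v ∈ ℂ^n with v ≠ 0 and p·v = 0 satisfy the tangency equation (v·(p−c))² = (v·v)·((p−c)² − r²) for every center c of the configuration. Then v·v ≠ 0, p_j = 0 for all 4 ≤ j ≤ n, and v_1·v_2·v_3 = 0. -/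
open scoped BigOperators

/-- The standard inclusion `ℝⁿ ⊆ ℂⁿ`. -/
def toC {n : ℕ} (c : Fin n → ℝ) : Fin n → ℂ := fun j => (c j : ℂ)

/-- The tetrahedron vertex `(1,1,1,0,…,0)` of `ℝⁿ`. -/
def tetraA (n : ℕ) : Fin n → ℝ := fun i =>
  if i.val = 0 then 1 else if i.val = 1 then 1 else if i.val = 2 then 1 else 0

/-- The tetrahedron vertex `(1,−1,−1,0,…,0)` of `ℝⁿ`. -/
def tetraB (n : ℕ) : Fin n → ℝ := fun i =>
  if i.val = 0 then 1 else if i.val = 1 then -1 else if i.val = 2 then -1 else 0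

/-- The tetrahedron vertex `(−1,1,−1,0,…,0)` of `ℝⁿ`. -/
def tetraC (n : ℕ) : Fin n → ℝ := fun i =>
  if i.val = 0 then -1 else if i.val = 1 then 1 else if i.val = 2 then -1 else 0

/-- The tetrahedron vertex `(−1,−1,1,0,…,0)` of `ℝⁿ`. -/
def tetraD (n : ℕ) : Fin n → ℝ := fun i =>
  if i.val = 0 then -1 else if i.val = 1 then -1 else if i.val = 2 then 1 else 0

/-- The `2n−2` centers: the four tetrahedron vertices together with `±a·eⱼ` for
`j = 4,…,n` (in 1-based indexing; `3 ≤ j.val` in the 0-based indexing of `Fin n`). -/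
def configCenters (n : ℕ) (a : ℝ) : Set (Fin n → ℝ) :=
  {tetraA n, tetraB n, tetraC n, tetraD n} ∪
    {x | ∃ j : Fin n, 3 ≤ j.val ∧
      (x = a • (Pi.single j 1 : Fin n → ℝ) ∨ x = -(a • (Pi.single j 1 : Fin n → ℝ)))}

theorem dotc_single {n : ℕ} (v : Fin n → ℂ) (a : ℝ) (j : Fin n) :
    dotc v (toC (a • (Pi.single j 1 : Fin n → ℝ))) = a * v j := by
  simp [dotc, toC, Pi.single_apply, apply_ite Complex.ofReal, mul_comm]

theorem dotc_single_self {n : ℕ} (a : ℝ) (j : Fin n) :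
    dotc (toC (a • (Pi.single j 1 : Fin n → ℝ))) (toC (a • (Pi.single j 1 : Fin n → ℝ))) =
      (a : ℂ) ^ 2 := by
  rw [dotc_single]
  simp [toC, sq]

theorem dotc_neg_right {n : ℕ} (v : Fin n → ℂ) (c : Fin n → ℝ) :
    dotc v (toC (-c)) = -dotc v (toC c) := by
  simp [dotc, toC]

theorem dotc_neg_neg {n : ℕ} (c : Fin n → ℝ) :
    dotc (toC (-c)) (toC (-c)) = dotc (toC c) (toC c) := by
  simp [dotc, toC]

theorem dotc_add_three {m : ℕ} (x y : Fin (m + 3) → ℂ) :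
    dotc x y = x ⟨0, by omega⟩ * y ⟨0, by omega⟩ + x ⟨1, by omega⟩ * y ⟨1, by omega⟩ +
      x ⟨2, by omega⟩ * y ⟨2, by omega⟩ + ∑ i : Fin m, x i.succ.succ.succ * y i.succ.succ.succ := by
  simp only [dotc, Fin.sum_univ_succ, ← add_assoc]
  rfl

/-- With `p·v = 0`, the tangency equation reads `(v·c)² = v²(p² - 2p·c + c² - r²)`. -/
theorem tangency_expand {n : ℕ} {p v c : Fin n → ℂ} {R : ℂ} (hpv : dotc p v = 0)
    (h : dotc v (p - c) ^ 2 = dotc v v * (dotc (p - c) (p - c) - R)) :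
    dotc v c ^ 2 = dotc v v * (dotc p p - 2 * dotc p c + dotc c c - R) := by
  have h1 : dotc v (p - c) = dotc p v - dotc v c := by
    simp only [dotc, Pi.sub_apply, ← Finset.sum_sub_distrib]
    exact Finset.sum_congr rfl fun i _ => by ring
  have h2 : dotc (p - c) (p - c) = dotc p p - 2 * dotc p c + dotc c c := by
    simp only [dotc, Pi.sub_apply, Finset.mul_sum, ← Finset.sum_sub_distrib,
      ← Finset.sum_add_distrib]
    exact Finset.sum_congr rfl fun i _ => by ring
  rw [h1, h2, hpv] at h
  linear_combination h

/-- if the line through `p` with nonzero direction `v` (normalized so that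
`p·v = 0`) is tangent to every sphere of the tetrahedron-plus-crosspolytope configuration,
then `v·v ≠ 0`, `pⱼ = 0` for `4 ≤ j ≤ n` (1-based), and `v₁v₂v₃ = 0`. -/
theorem tangent_line_structure (n : ℕ) (hn : 4 ≤ n) (a r : ℝ) (ha : 0 < a) (hr : 0 < r)
    (p v : Fin n → ℂ) (hv : v ≠ 0) (hpv : dotc p v = 0)
    (htan : ∀ c ∈ configCenters n a,
      dotc v (p - toC c) ^ 2 = dotc v v * (dotc (p - toC c) (p - toC c) - (r : ℂ) ^ 2)) :
    dotc v v ≠ 0 ∧ (∀ j : Fin n, 3 ≤ j.val → p j = 0) ∧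
      v ⟨0, by omega⟩ * v ⟨1, by omega⟩ * v ⟨2, by omega⟩ = 0 := by
  obtain ⟨m, rfl⟩ : ∃ m, n = m + 3 := ⟨n - 3, by omega⟩
  have ha' : (a : ℂ) ≠ 0 := by exact_mod_cast ha.ne'
  have key := fun c hc => tangency_expand hpv (htan c hc)
  have hax : ∀ j : Fin (m + 3), 3 ≤ j.val → dotc v v * p j = 0 ∧
      (a : ℂ) ^ 2 * v j ^ 2 = dotc v v * (dotc p p + a ^ 2 - r ^ 2) := by
    intro j hj
    have h1 := key _ (Or.inr ⟨j, hj, Or.inl rfl⟩)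
    have h2 := key _ (Or.inr ⟨j, hj, Or.inr rfl⟩)
    rw [dotc_neg_neg, dotc_neg_right, dotc_neg_right] at h2
    rw [dotc_single_self, dotc_single, dotc_single] at h1 h2
    constructor
    · refine mul_left_cancel₀ (mul_ne_zero (by norm_num : (4 : ℂ) ≠ 0) ha') ?_
      linear_combination h1 - h2
    · linear_combination (h1 + h2) / 2
  have hA := key (tetraA _) (by simp [configCenters])
  have hB := key (tetraB _) (by simp [configCenters])
  have hC := key (tetraC _) (by simp [configCenters])
  have hD := key (tetraD _) (by simp [configCenters])
  generalize hV : dotc v v = V at *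
  generalize dotc p p = P at *
  simp [dotc_add_three, toC, tetraA] at hA
  simp [dotc_add_three, toC, tetraB] at hB
  simp [dotc_add_three, toC, tetraC] at hC
  simp [dotc_add_three, toC, tetraD] at hD
  have hV0 : V ≠ 0 := by
    rintro rfl
    simp only [zero_mul, sq_eq_zero_iff] at hA hB hC hD
    refine hv (funext fun j => ?_)
    by_cases hj : 3 ≤ j.val
    · have h := (hax j hj).2
      simpa [ha'] using h
    · obtain ⟨j, hjm⟩ := j
      have : j = 0 ∨ j = 1 ∨ j = 2 := by simp at hj; omega
      rcases this with rfl | rfl | rfl <;> simp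
      · linear_combination (hA + hB) / 2
      · linear_combination (hA + hC) / 2
      · linear_combination (hA + hD) / 2
  have hp : ∀ j : Fin (m + 3), 3 ≤ j.val → p j = 0 := fun j hj =>
    (mul_eq_zero.mp (hax j hj).1).resolve_left hV0
  refine ⟨hV0, hp, ?_⟩
  rw [dotc_add_three, Finset.sum_eq_zero fun i _ => by rw [hp _ (by simp), zero_mul]] at hpv
  simp only [Fin.zero_eta, Fin.mk_one] at hpv ⊢
  linear_combination (v 0 * (hA + hB - hC - hD) + v 1 * (hA - hB + hC - hD) +
    v ⟨2, by omega⟩ * (hA - hB - hC + hD)) / 24 - V / 3 * hpv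
end
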